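/- arXiv:1005.0812 — 2 statements merged into one kernel-verified Lean document; each statement's English description precedes it below -/
import Mathlib

section
/- Assume Conditions A1–A4 with Hölder exponent β. Fix t ∈ T, a ∈ (0,1), b > 0, z > 0, and set γ = b − a/b and x = γ + z/γ. Let f̃ be the Gaussian random field on T with mean function μ̃(s) = μ(s) + σ(t)^{-2} C(t,s)(x − μ(t)) and covariance function C_g(s,s′) = C(s,s′) − σ(t)^{-2} C(t,s) C(t,s′), i.e. the conditional law of f given f(t) = x, and put Ã_u = {s ∈ T : f̃(s) > u}. Then for any v > 0 there exist constants κ and λ₂ ∈ (0,∞) such that for all t ∈ T, all sufficiently small a, all z > 0, and all y > 0 with y^{−β/d} ≤ a^{2+v}/(κ b^{2+v}), P( m(Ã_γ)^{-1} > y and m(Ã_b) > 0 ) ≤ exp( −λ₂ a² y^{β/d} / b² ). -/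
open MeasureTheory ProbabilityTheory Filter
open scoped Classical

noncomputable section

/-- The ℓ¹ norm `|x| = ∑ⱼ |xⱼ|` on `ℝ^d`. -/
def nrm {d : ℕ} (x : Fin d → ℝ) : ℝ := ∑ j, |x j|

/-- The conditional mean function of the field given `f(t₀) = x`. -/
def condMean {d : ℕ} (μ : (Fin d → ℝ) → ℝ) (C : (Fin d → ℝ) → (Fin d → ℝ) → ℝ)
    (σ : (Fin d → ℝ) → ℝ) (t₀ : Fin d → ℝ) (x : ℝ) (s : Fin d → ℝ) : ℝ :=
  μ s + C t₀ s * (x - μ t₀) / (σ t₀) ^ 2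

/-- The conditional covariance function of the field given the value at `t₀`. -/
def condCov {d : ℕ} (C : (Fin d → ℝ) → (Fin d → ℝ) → ℝ) (σ : (Fin d → ℝ) → ℝ)
    (t₀ : Fin d → ℝ) (s s' : Fin d → ℝ) : ℝ :=
  C s s' - C t₀ s * C t₀ s' / (σ t₀) ^ 2

/-- Two-sided tail bound for a real Gaussian variable whose variance is at most `V`. -/
theorem gaussian_abs_tail {Ω' : Type*} [MeasurableSpace Ω'] {P : Measure Ω'}
    [IsProbabilityMeasure P] {X : Ω' → ℝ} (hX : Measurable X) {m : ℝ} {w V : NNReal}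
    (hlaw : P.map X = gaussianReal m w) (hwV : w ≤ V) {u : ℝ} (hu : 0 ≤ u) :
    P.real {ω | u ≤ |X ω - m|} ≤ 2 * Real.exp (-u ^ 2 / (2 * V)) := by
  have hY : P.map (fun ω => X ω - m) = gaussianReal 0 w := by
    have := Measure.map_map (μ := P) (measurable_id.sub_const m) hX
    rw [hlaw] at this
    have h2 := gaussianReal_map_sub_const (μ := m) (v := w) m
    rw [sub_self] at h2
    rw [← h2]
    exact this.symm
  have hsub : HasSubgaussianMGF (fun ω => X ω - m) V P := by
    refine ⟨fun t => ?_, fun t => ?_⟩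
    · have := integrable_exp_mul_gaussianReal (μ := 0) (v := w) t
      rw [← hY] at this
      exact this.comp_measurable (hX.sub_const m)
    · rw [mgf_gaussianReal hY]
      apply Real.exp_le_exp.2
      have : (w : ℝ) ≤ V := by exact_mod_cast hwV
      rw [zero_mul, zero_add]
      gcongr
  have h1 := hsub.measure_ge_le hu
  have h2 := hsub.neg.measure_ge_le hu
  have hss : {ω | u ≤ |X ω - m|} ⊆ {ω | u ≤ X ω - m} ∪ {ω | u ≤ (-fun ω => X ω - m) ω} := by
    intro ω hω
    have hω' : u ≤ |X ω - m| := hω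
    exact le_abs.1 hω'
  calc _ ≤ _ := measureReal_mono hss
    _ ≤ _ := measureReal_union_le _ _
    _ ≤ _ := by linarith

theorem memLp_two_of_gaussian {Ω' : Type*} [MeasurableSpace Ω'] {P : Measure Ω'}
    {X : Ω' → ℝ} (hX : Measurable X) {m : ℝ} {w : NNReal}
    (hlaw : P.map X = gaussianReal m w) : MemLp X 2 P := by
  have h := memLp_id_gaussianReal (μ := m) (v := w) 2
  rw [← hlaw] at h
  exact (memLp_map_measure_iff (by fun_prop) hX.aemeasurable).1 h

/-- Tail bound for the centred increment of a Gaussian field with mean `M` and covariance `K`. -/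
theorem gaussian_increment_tail {Ω' E : Type*} [MeasurableSpace Ω'] {P : Measure Ω'}
    [IsProbabilityMeasure P] {T : Set E} {f : E → Ω' → ℝ} (hf : ∀ s, Measurable (f s))
    (hG : ∀ (n : ℕ) (u : Fin n → E), (∀ i, u i ∈ T) → ∀ c : Fin n → ℝ,
      ∃ (m : ℝ) (w : NNReal), P.map (fun ω => ∑ i, c i * f (u i) ω) = gaussianReal m w)
    {M : E → ℝ} {K : E → E → ℝ} (hM : ∀ s ∈ T, ∫ ω, f s ω ∂P = M s)
    (hK : ∀ s ∈ T, ∀ s' ∈ T, ∫ ω, (f s ω - M s) * (f s' ω - M s') ∂P = K s s')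
    {s s' : E} (hs : s ∈ T) (hs' : s' ∈ T) {V : ℝ} (hV0 : 0 ≤ V)
    (hV : K s s + K s' s' - 2 * K s s' ≤ V) {u : ℝ} (hu : 0 ≤ u) :
    P.real {ω | u ≤ |(f s ω - M s) - (f s' ω - M s')|} ≤ 2 * Real.exp (-u ^ 2 / (2 * V)) := by
  have hL : ∀ p ∈ T, MemLp (f p) 2 P := by
    intro p hp
    obtain ⟨m, w, h⟩ := hG 1 (fun _ => p) (fun _ => hp) (fun _ => 1)
    simp only [Fin.sum_univ_one, one_mul] at h
    exact memLp_two_of_gaussian (hf p) h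
  obtain ⟨m, w, h⟩ := hG 2 ![s, s'] (by intro i; fin_cases i <;> simpa) ![1, -1]
  have hX : Measurable (fun ω => f s ω - f s' ω) := (hf s).sub (hf s')
  have hfun : (fun ω => ∑ i, (![1, -1] : Fin 2 → ℝ) i * f ((![s, s'] : Fin 2 → E) i) ω)
      = fun ω => f s ω - f s' ω := by
    funext ω
    simp [Fin.sum_univ_two, sub_eq_add_neg]
  rw [hfun] at h
  have hm : m = M s - M s' := by
    have h1 : ∫ ω, (f s ω - f s' ω) ∂P = M s - M s' := by
      rw [integral_sub ((hL s hs).integrable (by norm_num)) ((hL s' hs').integrable (by norm_num)),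
        hM s hs, hM s' hs']
    rw [← h1, ← integral_id_gaussianReal (μ := m) (v := w), ← h,
      integral_map hX.aemeasurable (by fun_prop)]
  have hc : ∀ p ∈ T, MemLp (fun ω => f p ω - M p) 2 P := fun p hp =>
    (hL p hp).sub (memLp_const _)
  have hw : (w : ℝ) = K s s + K s' s' - 2 * K s s' := by
    have h1 : (w : ℝ) = Var[fun ω => f s ω - f s' ω; P] := by
      rw [← variance_id_gaussianReal (μ := m) (v := w), ← h, variance_id_map hX.aemeasurable]
    rw [h1, variance_eq_integral hX.aemeasurable]
    have h2 : ∫ ω, (f s ω - f s' ω) ∂P = M s - M s' := by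
      rw [integral_sub ((hL s hs).integrable (by norm_num)) ((hL s' hs').integrable (by norm_num)),
        hM s hs, hM s' hs']
    rw [h2, ← hK s hs s hs, ← hK s' hs' s' hs', ← hK s hs s' hs']
    have i1 := (hc s hs).integrable_mul (hc s hs)
    have i2 := (hc s' hs').integrable_mul (hc s' hs')
    have i3 := (hc s hs).integrable_mul (hc s' hs')
    rw [← integral_const_mul, ← integral_add, ← integral_sub]
    · congr 1
      funext ω
      ring
    · exact i1.add i2
    · exact i3.const_mul 2
    · exact i1
    · exact i2
  have hwV : w ≤ V.toNNReal := by
    rw [← NNReal.coe_le_coe, Real.coe_toNNReal V hV0, hw]; exact hV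
  have := gaussian_abs_tail hX h hwV hu
  rw [Real.coe_toNNReal V hV0, hm] at this
  refine le_trans (le_of_eq ?_) this
  congr 1
  ext ω
  rw [Set.mem_ofPred_eq, Set.mem_ofPred_eq,
    show f s ω - M s - (f s' ω - M s') = f s ω - f s' ω - (M s - M s') by ring]

theorem ae_eq_of_centred_sq {Ω' : Type*} [MeasurableSpace Ω'] {P : Measure Ω'}
    [IsProbabilityMeasure P] {X : Ω' → ℝ} (hX : MemLp X 2 P) {c : ℝ}
    (h0 : ∫ ω, (X ω - c) * (X ω - c) ∂P = 0) : ∀ᵐ ω ∂P, X ω = c := by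
  have hc : MemLp (fun ω => X ω - c) 2 P := hX.sub (memLp_const _)
  have i1 : Integrable (fun ω => (X ω - c) * (X ω - c)) P := hc.integrable_mul hc
  have := (integral_eq_zero_iff_of_nonneg (fun ω => mul_self_nonneg (X ω - c)) i1).1 h0
  filter_upwards [this] with ω hω
  exact sub_eq_zero.1 (mul_self_eq_zero.1 hω)

theorem nrm_nonneg {d : ℕ} (x : Fin d → ℝ) : 0 ≤ nrm x :=
  Finset.sum_nonneg fun _ _ => abs_nonneg _

theorem nrm_sub_comm {d : ℕ} (x y : Fin d → ℝ) : nrm (x - y) = nrm (y - x) := by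
  simp only [nrm, Pi.sub_apply, abs_sub_comm]

theorem nrm_sub_le {d : ℕ} (x y z : Fin d → ℝ) : nrm (x - z) ≤ nrm (x - y) + nrm (y - z) := by
  simp only [nrm, Pi.sub_apply]
  rw [← Finset.sum_add_distrib]
  exact Finset.sum_le_sum fun i _ => abs_sub_le _ _ _

theorem continuous_nrm {d : ℕ} : Continuous (nrm : (Fin d → ℝ) → ℝ) := by
  unfold nrm
  fun_prop

theorem dist_le_nrm_sub {d : ℕ} (x y : Fin d → ℝ) : dist x y ≤ nrm (x - y) := by
  rw [dist_pi_le_iff (nrm_nonneg _)]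
  intro i
  rw [Real.dist_eq]
  exact Finset.single_le_sum (f := fun j => |(x - y) j|) (fun j _ => abs_nonneg _)
    (Finset.mem_univ i)

/-- Bounded sets have `ε`-nets inside themselves of cardinality `O(ε⁻ᵈ)`. -/
theorem exists_net {d : ℕ} (hd : 0 < d) {T : Set (Fin d → ℝ)} (hT : Bornology.IsBounded T) :
    ∃ K : ℝ, 0 < K ∧ ∀ ε : ℝ, 0 < ε → ε ≤ 1 → ∃ N : Finset (Fin d → ℝ),
      (∀ p ∈ N, p ∈ T) ∧ (N.card : ℝ) ≤ K * ε⁻¹ ^ d ∧ ∀ s ∈ T, ∃ p ∈ N, nrm (s - p) ≤ ε := by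
  obtain ⟨M, hM0, hM⟩ := hT.exists_pos_norm_le
  have hd' : (0 : ℝ) < d := by exact_mod_cast hd
  refine ⟨(2 * M * d + 5) ^ d, by positivity, fun ε hε hε1 => ?_⟩
  let φ : (Fin d → ℝ) → (Fin d → ℤ) := fun s i => ⌊s i * (d / ε)⌋
  set L : ℤ := ⌈M * d / ε⌉ + 1 with hL
  have hLpos : 0 ≤ L := by
    have : 0 ≤ ⌈M * d / ε⌉ := Int.ceil_nonneg (by positivity)
    omega
  let B : Finset (Fin d → ℤ) := Fintype.piFinset fun _ => Finset.Icc (-L) L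
  have hφB : ∀ s ∈ T, φ s ∈ B := by
    intro s hs
    rw [Fintype.mem_piFinset]
    intro i
    have h1 : |s i| ≤ M := (norm_le_pi_norm s i).trans (hM s hs)
    rw [abs_le] at h1
    have h3 : M * d / ε = M * (d / ε) := by ring
    have hpos : 0 < (d : ℝ) / ε := by positivity
    have hc := Int.le_ceil (M * d / ε)
    rw [Finset.mem_Icc]
    constructor
    · apply Int.le_floor.2
      rw [hL]
      push_cast
      nlinarith
    · have : (φ s i : ℝ) ≤ L := by
        refine (Int.floor_le _).trans ?_
        rw [hL]
        push_cast
        nlinarith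
      exact_mod_cast this
  let pick : (Fin d → ℤ) → (Fin d → ℝ) := fun k =>
    if h : ∃ s ∈ T, φ s = k then h.choose else 0
  have hpick : ∀ k, (∃ s ∈ T, φ s = k) → pick k ∈ T ∧ φ (pick k) = k := by
    intro k h
    have : pick k = h.choose := dif_pos h
    rw [this]
    exact h.choose_spec
  refine ⟨(B.filter fun k => ∃ s ∈ T, φ s = k).image pick, ?_, ?_, ?_⟩
  · intro p hp
    obtain ⟨k, hk, rfl⟩ := Finset.mem_image.1 hp
    exact (hpick k (Finset.mem_filter.1 hk).2).1
  · have h1 : ((B.filter fun k => ∃ s ∈ T, φ s = k).image pick).card ≤ B.card :=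
      Finset.card_image_le.trans (Finset.card_filter_le _ _)
    have h2 : (B.card : ℝ) = (2 * L + 1 : ℝ) ^ d := by
      have : B.card = (2 * L + 1).toNat ^ d := by
        simp only [B, Fintype.card_piFinset, Int.card_Icc, Finset.prod_const, Finset.card_univ,
          Fintype.card_fin]
        congr 2
        ring
      rw [this]
      push_cast
      congr 1
      have h3 : ((2 * L + 1).toNat : ℤ) = 2 * L + 1 := Int.toNat_of_nonneg (by omega)
      exact_mod_cast h3
    calc _ ≤ (B.card : ℝ) := by exact_mod_cast h1
      _ = (2 * L + 1 : ℝ) ^ d := h2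
      _ ≤ ((2 * M * d + 5) * ε⁻¹) ^ d := by
        have hL0 : (0 : ℝ) ≤ L := by exact_mod_cast hLpos
        gcongr
        have hc := (Int.ceil_lt_add_one (M * d / ε)).le
        have h5 : 1 ≤ ε⁻¹ := (one_le_inv₀ hε).2 hε1
        rw [hL]
        push_cast
        rw [div_eq_mul_inv] at hc ⊢
        nlinarith
      _ = _ := mul_pow _ _ _
  · intro s hs
    have hk : ∃ s' ∈ T, φ s' = φ s := ⟨s, hs, rfl⟩
    refine ⟨pick (φ s), Finset.mem_image_of_mem _ (Finset.mem_filter.2 ⟨hφB s hs, hk⟩), ?_⟩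
    have h1 := (hpick _ hk).2
    have h2 : ∀ i, |(s - pick (φ s)) i| ≤ ε / d := by
      intro i
      have h3 : ⌊(pick (φ s)) i * (d / ε)⌋ = ⌊s i * (d / ε)⌋ := congrFun h1 i
      have h4 := Int.abs_sub_lt_one_of_floor_eq_floor h3.symm
      rw [← sub_mul, abs_mul, abs_of_pos (show 0 < (d : ℝ) / ε by positivity)] at h4
      rw [Pi.sub_apply, le_div_iff₀ hd']
      rw [← mul_div_assoc, div_lt_one hε] at h4
      exact h4.le
    calc nrm (s - pick (φ s)) ≤ ∑ _j : Fin d, ε / d := Finset.sum_le_sum fun i _ => h2 i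
      _ = ε := by
        rw [Finset.sum_const, Finset.card_univ, Fintype.card_fin, nsmul_eq_mul]
        field_simp

/-- Deterministic chaining: geometric control of the increments along nets of mesh `h / 2 ^ n`
controls the modulus of continuity at scale `h`. -/
theorem abs_sub_lt_of_chain {d : ℕ} {T : Set (Fin d → ℝ)} {g : (Fin d → ℝ) → ℝ}
    (hg : ContinuousOn g T) {h η ρ : ℝ} (hρ1 : ρ < 1)
    {N : ℕ → Finset (Fin d → ℝ)} (hNT : ∀ n, ∀ p ∈ N n, p ∈ T)
    (hN : ∀ n, ∀ s ∈ T, ∃ p ∈ N n, nrm (s - p) ≤ h / 2 ^ n)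
    (hcoarse : ∀ p ∈ N 0, ∀ q ∈ N 0, nrm (p - q) ≤ 3 * h → |g p - g q| < η / 3)
    (hfine : ∀ n, ∀ p ∈ N n, ∀ q ∈ N (n + 1), nrm (p - q) ≤ 2 * h / 2 ^ n →
      |g p - g q| < η * (1 - ρ) / 3 * ρ ^ n)
    {s s' : Fin d → ℝ} (hs : s ∈ T) (hs' : s' ∈ T) (hss : nrm (s - s') ≤ h) :
    |g s - g s'| < η := by
  have hh : 0 ≤ h := (nrm_nonneg _).trans hss
  have key : ∀ x ∈ T, ∃ p ∈ N 0, nrm (x - p) ≤ h ∧ |g p - g x| ≤ η / 3 := by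
    intro x hx
    choose π hπN hπ using fun n => hN n x hx
    refine ⟨π 0, hπN 0, by simpa using hπ 0, ?_⟩
    have hlim : Tendsto π atTop (nhds x) := by
      rw [tendsto_iff_dist_tendsto_zero]
      have hz : Tendsto (fun n : ℕ => h / 2 ^ n) atTop (nhds 0) :=
        tendsto_const_nhds.div_atTop (tendsto_pow_atTop_atTop_of_one_lt one_lt_two)
      refine squeeze_zero (fun _ => dist_nonneg) (fun n => ?_) hz
      rw [dist_comm]
      exact (dist_le_nrm_sub _ _).trans (hπ n)
    have hglim : Tendsto (fun n => g (π n)) atTop (nhds (g x)) :=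
      (hg x hx).tendsto.comp (tendsto_nhdsWithin_iff.2
        ⟨hlim, Eventually.of_forall fun n => hNT n _ (hπN n)⟩)
    have hstep : ∀ n, dist (g (π n)) (g (π (n + 1))) ≤ η * (1 - ρ) / 3 * ρ ^ n := by
      intro n
      refine (hfine n _ (hπN n) _ (hπN (n + 1)) ?_).le
      have h1 := hπ n
      have h2 := hπ (n + 1)
      rw [nrm_sub_comm] at h1
      have h3 : h / 2 ^ (n + 1) ≤ h / 2 ^ n := by gcongr <;> norm_num
      calc _ ≤ _ := nrm_sub_le _ x _
        _ ≤ h / 2 ^ n + h / 2 ^ n := by linarith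
        _ = _ := by ring
    have := dist_le_of_le_geometric_of_tendsto₀ ρ _ hρ1 hstep hglim
    rw [Real.dist_eq] at this
    refine this.trans (le_of_eq ?_)
    have : 1 - ρ ≠ 0 := by linarith
    field_simp
  obtain ⟨p, hp, hsp, hgp⟩ := key s hs
  obtain ⟨q, hq, hsq, hgq⟩ := key s' hs'
  have hpq : nrm (p - q) ≤ 3 * h := by
    have h1 := nrm_sub_le p s q
    have h2 := nrm_sub_le s s' q
    rw [nrm_sub_comm] at hsp
    linarith
  have h1 := hcoarse p hp q hq hpq
  rw [abs_sub_lt_iff] at h1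
  rw [abs_sub_le_iff] at hgp hgq
  rw [abs_sub_lt_iff]
  constructor <;> linarith [h1.1, h1.2, hgp.1, hgp.2, hgq.1, hgq.2]

theorem measureReal_pairs_le {Ω' E : Type*} [MeasurableSpace Ω'] {P : Measure Ω'}
    [IsProbabilityMeasure P] (N N' : Finset E) (S : E → E → Set Ω') {x : ℝ}
    (hS : ∀ p ∈ N, ∀ q ∈ N', P.real (S p q) ≤ x) :
    P.real (⋃ p ∈ N ×ˢ N', S p.1 p.2) ≤ N.card * N'.card * x := by
  calc _ ≤ ∑ p ∈ N ×ˢ N', P.real (S p.1 p.2) := measureReal_biUnion_finset_le _ _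
    _ ≤ ∑ _p ∈ N ×ˢ N', x := Finset.sum_le_sum fun p hp =>
      hS _ (Finset.mem_product.1 hp).1 _ (Finset.mem_product.1 hp).2
    _ = _ := by
      rw [Finset.sum_const, Finset.card_product, nsmul_eq_mul]
      push_cast
      ring

theorem measureReal_iUnion_le_geometric {Ω' : Type*} [MeasurableSpace Ω'] {P : Measure Ω'}
    [IsProbabilityMeasure P] (B : ℕ → Set Ω') {x : ℝ} (hx : 0 ≤ x)
    (hB : ∀ n, P.real (B n) ≤ x * (1 / 2) ^ n) : P.real (⋃ n, B n) ≤ 2 * x := by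
  have hsum : Summable fun n : ℕ => x * (1 / 2 : ℝ) ^ n := summable_geometric_two.mul_left x
  have hle : P (⋃ n, B n) ≤ ENNReal.ofReal (2 * x) := by
    calc _ ≤ ∑' n, P (B n) := measure_iUnion_le _
      _ ≤ ∑' n : ℕ, ENNReal.ofReal (x * (1 / 2) ^ n) := by
        refine ENNReal.tsum_le_tsum fun n => ?_
        rw [← ofReal_measureReal (μ := P) (s := B n)]
        exact ENNReal.ofReal_le_ofReal (hB n)
      _ = ENNReal.ofReal (2 * x) := by
        rw [← ENNReal.ofReal_tsum_of_nonneg (fun n => by positivity) hsum, tsum_mul_left,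
          tsum_geometric_two, mul_comm]
  exact ENNReal.toReal_le_of_le_ofReal (by positivity) hle

/-- Chaining bound for the modulus of continuity of a process with Gaussian increments whose
variance is Hölder of order `β`. -/
theorem exists_modulus_tail {d : ℕ} {T : Set (Fin d → ℝ)} {K β V : ℝ} (δ : ℝ)
    (hK : 0 < K) (hβ : 0 < β) (hV : 0 < V)
    (hnet : ∀ ε : ℝ, 0 < ε → ε ≤ 1 → ∃ N : Finset (Fin d → ℝ),
      (∀ p ∈ N, p ∈ T) ∧ (N.card : ℝ) ≤ K * ε⁻¹ ^ d ∧ ∀ s ∈ T, ∃ p ∈ N, nrm (s - p) ≤ ε) :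
    ∃ A c Q₀ : ℝ, 0 < A ∧ 0 < c ∧ 0 < Q₀ ∧
      ∀ (Ω' : Type) (_ : MeasurableSpace Ω') (P : Measure Ω') (_ : IsProbabilityMeasure P)
        (g : (Fin d → ℝ) → Ω' → ℝ) (h η : ℝ), 0 < h → h ≤ 1 → 3 * h < δ → 0 < η →
        Q₀ ≤ η ^ 2 / h ^ β →
        (∀ s ∈ T, ∀ s' ∈ T, ∀ r : ℝ, 0 < r → r < δ → nrm (s - s') ≤ r → ∀ u : ℝ, 0 ≤ u →
          P.real {ω | u ≤ |g s ω - g s' ω|} ≤ 2 * Real.exp (-u ^ 2 / (2 * (V * r ^ β)))) →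
        (∀ᵐ ω ∂P, ContinuousOn (fun s => g s ω) T) →
        P.real {ω | ∃ s ∈ T, ∃ s' ∈ T, nrm (s - s') ≤ h ∧ η ≤ |g s ω - g s' ω|} ≤
          A * (h⁻¹ ^ d) ^ 2 * Real.exp (-(c * (η ^ 2 / h ^ β))) := by
  set ρ : ℝ := 2 ^ (-β / 4) with hρ
  have hρ0 : 0 < ρ := by positivity
  have hρ1 : ρ < 1 := Real.rpow_lt_one_of_one_lt_of_neg one_lt_two (by linarith)
  set R : ℝ := ρ ^ 2 * 2 ^ β with hR
  have hR1 : 1 < R := by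
    have : R = 2 ^ (β / 2) := by
      rw [hR, hρ, ← Real.rpow_natCast, ← Real.rpow_mul (by norm_num), ← Real.rpow_add (by norm_num)]
      congr 1
      push_cast
      ring
    rw [this]
    exact Real.one_lt_rpow one_lt_two (by linarith)
  set c : ℝ := (1 - ρ) ^ 2 / (18 * V * 3 ^ β) with hc
  have hρ' : 0 < 1 - ρ := by linarith
  have hc0 : 0 < c := by positivity
  have hν : 0 < R - 1 := by linarith
  refine ⟨2 * K ^ 2 + 2 * (2 * K ^ 2 * 2 ^ d), c, 2 * 4 ^ d / (c * (R - 1)), by positivity, hc0,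
    by positivity, ?_⟩
  intro Ω' _ P _ g h η hh hh1 hhδ hη hQ htail hcont
  set Q := η ^ 2 / h ^ β with hQdef
  have hhβ : 0 < h ^ β := by positivity
  have hQ0 : 0 < Q := by positivity
  choose N hNT hNc hN using fun n : ℕ => hnet (h / 2 ^ n) (by positivity)
    ((div_le_self hh.le (one_le_pow₀ one_le_two)).trans hh1)
  let S : ℝ → ℝ → (Fin d → ℝ) → (Fin d → ℝ) → Set Ω' := fun r u p q =>
    {ω | nrm (p - q) ≤ r ∧ u ≤ |g p ω - g q ω|}
  have hS : ∀ r u, 0 < r → r < δ → 0 ≤ u → ∀ p ∈ T, ∀ q ∈ T,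
      P.real (S r u p q) ≤ 2 * Real.exp (-u ^ 2 / (2 * (V * r ^ β))) := by
    intro r u hr hrδ hu p hp q hq
    by_cases hpq : nrm (p - q) ≤ r
    · exact (measureReal_mono fun ω hω => hω.2).trans (htail p hp q hq r hr hrδ hpq u hu)
    · have : S r u p q = ∅ := by
        ext ω
        exact ⟨fun hω => hpq hω.1, fun hω => hω.elim⟩
      rw [this, measureReal_empty]
      positivity
  set B₀ : Set Ω' := ⋃ p ∈ N 0 ×ˢ N 0, S (3 * h) (η / 3) p.1 p.2 with hB₀
  set B : ℕ → Set Ω' := fun n => ⋃ p ∈ N n ×ˢ N (n + 1),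
    S (2 * h / 2 ^ n) (η * (1 - ρ) / 3 * ρ ^ n) p.1 p.2 with hB
  have hsub : P.real {ω | ∃ s ∈ T, ∃ s' ∈ T, nrm (s - s') ≤ h ∧ η ≤ |g s ω - g s' ω|} ≤
      P.real (B₀ ∪ ⋃ n, B n) := by
    refine ENNReal.toReal_mono (measure_ne_top _ _) (measure_mono_ae ?_)
    filter_upwards [hcont] with ω hω hmem
    obtain ⟨s, hs, s', hs', hss, hle⟩ := hmem
    by_contra hnot
    have hnot0 : ω ∉ B₀ := fun hm => hnot (Or.inl hm)
    have hnotn : ∀ n, ω ∉ B n := fun n hm => hnot (Or.inr (Set.mem_iUnion.2 ⟨n, hm⟩))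
    refine absurd hle (not_le.2 (abs_sub_lt_of_chain hω hρ1 hNT hN ?_ ?_ hs hs' hss))
    · intro p hp q hq hpq
      by_contra hlt
      exact hnot0 (Set.mem_iUnion₂.2 ⟨(p, q), Finset.mem_product.2 ⟨hp, hq⟩, hpq, not_lt.1 hlt⟩)
    · intro n p hp q hq hpq
      by_contra hlt
      exact hnotn n
        (Set.mem_iUnion₂.2 ⟨(p, q), Finset.mem_product.2 ⟨hp, hq⟩, hpq, not_lt.1 hlt⟩)
  have hb0 : P.real B₀ ≤ 2 * K ^ 2 * (h⁻¹ ^ d) ^ 2 * Real.exp (-(c * Q)) := by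
    have h1 : P.real B₀ ≤ (N 0).card * (N 0).card *
        (2 * Real.exp (-(η / 3) ^ 2 / (2 * (V * (3 * h) ^ β)))) :=
      measureReal_pairs_le _ _ _ fun p hp q hq =>
        hS _ _ (by positivity) hhδ (by positivity) p (hNT 0 p hp) q (hNT 0 q hq)
    have h2 := hNc 0
    rw [pow_zero, div_one] at h2
    have h3 : -(η / 3) ^ 2 / (2 * (V * (3 * h) ^ β)) ≤ -(c * Q) := by
      rw [Real.mul_rpow (by norm_num) hh.le, neg_div, neg_le_neg_iff, hc, hQdef]
      have h4 : (1 - ρ) ^ 2 ≤ 1 := by nlinarith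
      calc (1 - ρ) ^ 2 / (18 * V * 3 ^ β) * (η ^ 2 / h ^ β)
          ≤ 1 / (18 * V * 3 ^ β) * (η ^ 2 / h ^ β) := by gcongr
        _ = _ := by field_simp; norm_num
    calc P.real B₀ ≤ (K * h⁻¹ ^ d) * (K * h⁻¹ ^ d) * (2 * Real.exp (-(c * Q))) := by
          refine h1.trans ?_
          gcongr
      _ = _ := by ring
  have hbn : ∀ n, P.real (B n) ≤
      2 * K ^ 2 * 2 ^ d * (h⁻¹ ^ d) ^ 2 * Real.exp (-(c * Q)) * (1 / 2) ^ n := by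
    intro n
    have h1 : P.real (B n) ≤ (N n).card * (N (n + 1)).card *
        (2 * Real.exp (-(η * (1 - ρ) / 3 * ρ ^ n) ^ 2 / (2 * (V * (2 * h / 2 ^ n) ^ β)))) := by
      refine measureReal_pairs_le _ _ _ fun p hp q hq =>
        hS _ _ (by positivity) ?_ (by positivity) p (hNT n p hp) q (hNT (n + 1) q hq)
      have : 2 * h / 2 ^ n ≤ 2 * h := div_le_self (by positivity) (one_le_pow₀ one_le_two)
      linarith
    have h3 : -(η * (1 - ρ) / 3 * ρ ^ n) ^ 2 / (2 * (V * (2 * h / 2 ^ n) ^ β)) ≤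
        -(c * Q) + n * (-(c * Q * (R - 1))) := by
      have e1 : (2 * h / 2 ^ n) ^ β = 2 ^ β * h ^ β / (2 ^ β) ^ n := by
        rw [Real.div_rpow (by positivity) (by positivity), Real.mul_rpow (by norm_num) hh.le,
          ← Real.rpow_natCast, ← Real.rpow_mul (by norm_num), mul_comm (n : ℝ) β,
          Real.rpow_mul (by norm_num), Real.rpow_natCast]
      have h23 : (2 : ℝ) ^ β ≤ 3 ^ β := Real.rpow_le_rpow (by norm_num) (by norm_num) hβ.le
      have hbern : 1 + (n : ℝ) * (R - 1) ≤ R ^ n := by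
        have := one_add_mul_le_pow (show (-2 : ℝ) ≤ R - 1 by linarith) n
        simpa using this
      have e2 : (η * (1 - ρ) / 3 * ρ ^ n) ^ 2 / (2 * (V * (2 * h / 2 ^ n) ^ β)) =
          (1 - ρ) ^ 2 / (18 * V * 2 ^ β) * Q * R ^ n := by
        rw [e1, hQdef, hR, mul_pow (ρ ^ 2)]
        field_simp
        ring
      have e3 : c ≤ (1 - ρ) ^ 2 / (18 * V * 2 ^ β) := by
        rw [hc]
        gcongr
      rw [neg_div, e2]
      have : c * Q * (1 + n * (R - 1)) ≤ (1 - ρ) ^ 2 / (18 * V * 2 ^ β) * Q * R ^ n := by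
        gcongr
      linarith
    have h4 : Real.exp (-(c * Q) + n * (-(c * Q * (R - 1)))) =
        Real.exp (-(c * Q)) * Real.exp (-(c * Q * (R - 1))) ^ n := by
      rw [Real.exp_add, Real.exp_nat_mul]
    have h5 : 4 ^ d * Real.exp (-(c * Q * (R - 1))) ≤ 1 / 2 := by
      have h6 : 2 * 4 ^ d ≤ c * Q * (R - 1) := by
        rw [div_le_iff₀ (by positivity)] at hQ
        linarith
      have h7 := Real.add_one_le_exp (c * Q * (R - 1))
      rw [Real.exp_neg, ← div_eq_mul_inv, div_le_iff₀ (Real.exp_pos _)]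
      linarith
    have h8 : (h / 2 ^ n)⁻¹ ^ d = h⁻¹ ^ d * (2 ^ d) ^ n := by
      rw [inv_div, div_eq_mul_inv, mul_pow, mul_comm, ← pow_mul, ← pow_mul, mul_comm n d]
    have h9 : (h / 2 ^ (n + 1))⁻¹ ^ d = h⁻¹ ^ d * (2 ^ d) ^ n * 2 ^ d := by
      rw [inv_div, div_eq_mul_inv, mul_pow, mul_comm, mul_assoc, ← pow_succ, ← pow_mul, ← pow_mul,
        mul_comm d]
    have c1 := hNc n
    have c2 := hNc (n + 1)
    rw [h8] at c1
    rw [h9] at c2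
    calc P.real (B n) ≤ (K * (h⁻¹ ^ d * (2 ^ d) ^ n)) * (K * (h⁻¹ ^ d * (2 ^ d) ^ n * 2 ^ d)) *
          (2 * (Real.exp (-(c * Q)) * Real.exp (-(c * Q * (R - 1))) ^ n)) := by
          refine h1.trans ?_
          rw [← h4]
          gcongr
      _ = 2 * K ^ 2 * 2 ^ d * (h⁻¹ ^ d) ^ 2 * Real.exp (-(c * Q)) *
          ((2 ^ d * 2 ^ d) * Real.exp (-(c * Q * (R - 1)))) ^ n := by
          rw [mul_pow, mul_pow]
          ring
      _ ≤ _ := by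
          rw [← mul_pow, show (2 : ℝ) * 2 = 4 by norm_num]
          gcongr
  calc _ ≤ P.real (B₀ ∪ ⋃ n, B n) := hsub
    _ ≤ P.real B₀ + P.real (⋃ n, B n) := measureReal_union_le _ _
    _ ≤ 2 * K ^ 2 * (h⁻¹ ^ d) ^ 2 * Real.exp (-(c * Q)) +
        2 * (2 * K ^ 2 * 2 ^ d * (h⁻¹ ^ d) ^ 2 * Real.exp (-(c * Q))) :=
      add_le_add hb0 (measureReal_iUnion_le_geometric _ (by positivity) hbn)
    _ = _ := by ring

theorem nrm_self_sub_rpow {d : ℕ} (x : Fin d → ℝ) {β : ℝ} (hβ : 0 < β) : nrm (x - x) ^ β = 0 := by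
  simp [Real.zero_rpow hβ.ne', nrm]

/-- A locally Hölder function is continuous. -/
theorem continuousOn_of_holder {d : ℕ} {T : Set (Fin d → ℝ)} {φ : (Fin d → ℝ) → ℝ} {β κ δ : ℝ}
    (hβ : 0 < β) (hδ : 0 < δ)
    (hφ : ∀ s ∈ T, ∀ t ∈ T, nrm (s - t) < δ → |φ t - φ s| ≤ κ * nrm (s - t) ^ β) :
    ContinuousOn φ T := by
  intro s hs
  have h1 : Tendsto (fun t => nrm (s - t)) (nhdsWithin s T) (nhds 0) := by
    have : Continuous fun t => nrm (s - t) := continuous_nrm.comp (by fun_prop)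
    have h2 := (this.tendsto s).mono_left (nhdsWithin_le_nhds (s := T))
    simpa [nrm] using h2
  have h3 : Tendsto (fun t => κ * nrm (s - t) ^ β) (nhdsWithin s T) (nhds 0) := by
    have := (h1.rpow_const (Or.inr hβ.le)).const_mul κ
    rwa [Real.zero_rpow hβ.ne', mul_zero] at this
  rw [ContinuousWithinAt, tendsto_iff_dist_tendsto_zero]
  refine squeeze_zero' (Eventually.of_forall fun _ => dist_nonneg) ?_ h3
  filter_upwards [h1.eventually (gt_mem_nhds hδ), self_mem_nhdsWithin] with t ht htT
  exact hφ s hs t htT ht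

/-- Increment variance of a field with Hölder standard deviation and correlation. -/
theorem increment_variance_le {σ₁ σ₂ c S κ R : ℝ} (h1 : 0 < σ₁) (h2 : 0 < σ₂) (h1S : σ₁ ≤ S)
    (h2S : σ₂ ≤ S) (hσ : |σ₁ - σ₂| ≤ κ * R) (hc : |1 - c / (σ₁ * σ₂)| ≤ κ * R) :
    σ₁ ^ 2 + σ₂ ^ 2 - 2 * c ≤ (S * κ + 2 * S ^ 2 * κ) * R := by
  have e : c = σ₁ * σ₂ * (c / (σ₁ * σ₂)) := by field_simp
  have hle : |σ₁ - σ₂| ≤ S := abs_le.2 ⟨by linarith, by linarith⟩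
  have hS : 0 < S := h1.trans_le h1S
  have hsq : (σ₁ - σ₂) ^ 2 ≤ S * (κ * R) := by
    rw [← sq_abs, sq]
    exact mul_le_mul hle hσ (abs_nonneg _) hS.le
  have hprod : σ₁ * σ₂ * (1 - c / (σ₁ * σ₂)) ≤ S * S * (κ * R) := by
    calc _ ≤ σ₁ * σ₂ * |1 - c / (σ₁ * σ₂)| := by gcongr; exact le_abs_self _
      _ ≤ _ := by gcongr
  rw [mul_sub, ← e] at hprod
  nlinarith

theorem condCov_increment_le {d : ℕ} (C : (Fin d → ℝ) → (Fin d → ℝ) → ℝ) (σ : (Fin d → ℝ) → ℝ)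
    (t s s' : Fin d → ℝ) :
    condCov C σ t s s + condCov C σ t s' s' - 2 * condCov C σ t s s' ≤
      C s s + C s' s' - 2 * C s s' := by
  have : 0 ≤ (C t s - C t s') ^ 2 / σ t ^ 2 := by positivity
  have e : (C t s - C t s') ^ 2 / σ t ^ 2 = C t s * C t s / σ t ^ 2 + C t s' * C t s' / σ t ^ 2 -
      2 * (C t s * C t s' / σ t ^ 2) := by ring
  unfold condCov
  linarith

/-- Hölder bound for the conditional mean function, linear in the conditioning value. -/
theorem abs_condMean_sub_le {d : ℕ} {μ : (Fin d → ℝ) → ℝ} {C : (Fin d → ℝ) → (Fin d → ℝ) → ℝ}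
    {σ : (Fin d → ℝ) → ℝ} {t s s' : Fin d → ℝ} {x S σm κ R : ℝ} (hx : 0 ≤ x) (hS : 0 ≤ S)
    (hκR : 0 ≤ κ * R)
    (hσm : 0 < σm) (ht : σm ≤ σ t) (hs : 0 < σ s) (hs' : 0 < σ s')
    (hs'S : σ s' ≤ S) (hμt : |μ t| ≤ S) (hCs : |C t s| ≤ σ t * σ s)
    (hA2 : |σ s - σ s'| + |μ s - μ s'| ≤ κ * R)
    (hA3 : |C t s / (σ t * σ s) - C t s' / (σ t * σ s')| ≤ κ * R) :
    |condMean μ C σ t x s - condMean μ C σ t x s'| ≤ (κ + κ * (1 + S) ^ 2 / σm) * R * (1 + x) := by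
  have htp : 0 < σ t := hσm.trans_le ht
  set r₁ := C t s / (σ t * σ s) with hr₁
  set r₂ := C t s' / (σ t * σ s') with hr₂
  have hr₁1 : |r₁| ≤ 1 := by
    rw [hr₁, abs_div, abs_of_pos (mul_pos htp hs), div_le_one (mul_pos htp hs)]
    exact hCs
  have e : condMean μ C σ t x s - condMean μ C σ t x s' =
      (μ s - μ s') + ((σ s - σ s') * r₁ + σ s' * (r₁ - r₂)) * ((x - μ t) / σ t) := by
    rw [hr₁, hr₂, condMean, condMean]
    field_simp
    ring
  have h1 : |(σ s - σ s') * r₁ + σ s' * (r₁ - r₂)| ≤ (1 + S) * (κ * R) := by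
    have a1 : |(σ s - σ s') * r₁| ≤ κ * R * 1 := by
      rw [abs_mul]
      exact mul_le_mul (by linarith [abs_nonneg (μ s - μ s')]) hr₁1 (abs_nonneg _) hκR
    have a2 : |σ s' * (r₁ - r₂)| ≤ S * (κ * R) := by
      rw [abs_mul, abs_of_pos hs']
      exact mul_le_mul hs'S hA3 (abs_nonneg _) hS
    linarith [abs_add_le ((σ s - σ s') * r₁) (σ s' * (r₁ - r₂))]
  have h2 : |(x - μ t) / σ t| ≤ (1 + S) * (1 + x) / σm := by
    rw [abs_div, abs_of_pos htp]
    have : |x - μ t| ≤ (1 + S) * (1 + x) := by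
      rw [abs_le] at hμt ⊢
      constructor <;> nlinarith
    gcongr
  have h3 : |μ s - μ s'| ≤ κ * R := by linarith [abs_nonneg (σ s - σ s')]
  rw [e]
  calc _ ≤ |μ s - μ s'| +
        |((σ s - σ s') * r₁ + σ s' * (r₁ - r₂)) * ((x - μ t) / σ t)| := abs_add_le _ _
    _ ≤ κ * R * (1 + x) + (1 + S) * (κ * R) * ((1 + S) * (1 + x) / σm) := by
      rw [abs_mul]
      gcongr
      nlinarith
    _ = _ := by ring

theorem volume_nrm_le_one_pos (d : ℕ) :
    0 < (volume {x : Fin d → ℝ | nrm x ≤ 1}).toReal := by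
  have hopen : IsOpen {x : Fin d → ℝ | nrm x < 1} := isOpen_lt continuous_nrm continuous_const
  have hsub : {x : Fin d → ℝ | nrm x ≤ 1} ⊆ Metric.closedBall 0 1 := by
    intro x hx
    have hx' : nrm x ≤ 1 := hx
    have := dist_le_nrm_sub x 0
    rw [sub_zero] at this
    exact this.trans hx'
  refine ENNReal.toReal_pos (ne_of_gt ?_)
    ((measure_mono hsub).trans_lt measure_closedBall_lt_top).ne
  refine (hopen.measure_pos volume ⟨0, ?_⟩).trans_le (measure_mono fun x (hx : nrm x < 1) =>
    show nrm x ≤ 1 from hx.le)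
  simp [nrm]

/-- A stretched exponential dominates every power. -/
theorem eventually_const_mul_rpow_le_exp {A p k θ : ℝ} (hk : 0 < k) (hθ : 0 < θ) :
    ∀ᶠ Y : ℝ in atTop, A * Y ^ p ≤ Real.exp (k * Y ^ θ) := by
  have h1 := (isLittleO_rpow_exp_pos_mul_atTop (p / θ) hk).const_mul_left A
  have h2 := (h1.bound one_pos).and (eventually_ge_atTop 0)
  filter_upwards [(tendsto_rpow_atTop hθ).eventually h2, eventually_ge_atTop 0] with Y hY hY0
  have := hY.1
  rw [one_mul, Real.norm_of_nonneg (Real.exp_pos _).le, ← Real.rpow_mul hY0,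
    mul_div_cancel₀ _ hθ.ne'] at this
  exact (le_abs_self _).trans this

/-- If `Y⁻¹ ≤ α ^ (2 + v)` then `α ^ 2 * Y` is at least a fixed positive power of `Y`. -/
theorem rpow_le_sq_mul_of_inv_le {α Y v : ℝ} (hα : 0 < α) (hY : 0 < Y) (hv : 0 < v)
    (h : Y⁻¹ ≤ α ^ (2 + v)) : Y ^ (v / (2 + v)) ≤ α ^ 2 * Y := by
  have h1 : (Y⁻¹) ^ (2 / (2 + v)) ≤ α ^ 2 := by
    have := Real.rpow_le_rpow (by positivity) h (show 0 ≤ 2 / (2 + v) by positivity)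
    rwa [← Real.rpow_mul hα.le, mul_div_cancel₀ _ (by positivity), Real.rpow_ofNat] at this
  calc Y ^ (v / (2 + v)) = (Y⁻¹) ^ (2 / (2 + v)) * Y := by
        rw [Real.inv_rpow hY.le, ← Real.rpow_neg hY.le]
        nth_rw 3 [← Real.rpow_one Y]
        rw [← Real.rpow_add hY]
        congr 1
        field_simp
        ring
    _ ≤ _ := by gcongr

/-- A point where `φ` exceeds `b` has, within distance `h`, a point where `φ ≤ γ`, once the
excursion set above `γ` is smaller than the part of `T` in the ball of radius `h`. -/
theorem exists_near_le_of_small_excursion {d : ℕ} {T : Set (Fin d → ℝ)} (hT : IsCompact T)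
    {φ : (Fin d → ℝ) → ℝ} {γ h w : ℝ} {p : Fin d → ℝ}
    (hball : w ≤ (volume ({s | nrm (s - p) ≤ h} ∩ T)).toReal)
    (hsmall : (volume {s | s ∈ T ∧ φ s > γ}).toReal < w) :
    ∃ s ∈ T, nrm (p - s) ≤ h ∧ φ s ≤ γ := by
  by_contra hcon
  push Not at hcon
  have hsub : {s | nrm (s - p) ≤ h} ∩ T ⊆ {s | s ∈ T ∧ φ s > γ} := by
    rintro s ⟨hs1, hs2⟩
    refine ⟨hs2, hcon s hs2 ?_⟩
    rw [nrm_sub_comm]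
    exact hs1
  have hfin : volume {s | s ∈ T ∧ φ s > γ} ≠ ⊤ :=
    ((measure_mono fun s hs => hs.1).trans_lt hT.measure_lt_top).ne
  linarith [ENNReal.toReal_mono hfin (measure_mono hsub)]

/-- Small excursion sets above `γ = b - a / b` together with a nonempty excursion above `b`
force a fluctuation of the centred field of size `a / (2 b)` at scale `h`. -/
theorem exists_fluctuation {d : ℕ} {T : Set (Fin d → ℝ)} (hT : IsCompact T)
    {φ M : (Fin d → ℝ) → ℝ} {t : Fin d → ℝ} (ht : t ∈ T) {a b z h w H : ℝ} (ha : 0 < a)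
    (ha2 : a ≤ 1 / 2) (hb : 1 ≤ b) (hz : 0 < z) (hH : H ≤ 1 / 6 * (a / b) ^ 2)
    (hφt : φ t = (b - a / b) + z / (b - a / b))
    (hM : ∀ s ∈ T, ∀ s' ∈ T, nrm (s - s') ≤ h →
      |M s - M s'| ≤ H * (1 + ((b - a / b) + z / (b - a / b))))
    (hball : ∀ p ∈ T, w ≤ (volume ({s | nrm (s - p) ≤ h} ∩ T)).toReal)
    (hsmall : (volume {s | s ∈ T ∧ φ s > b - a / b}).toReal < w)
    (hpos : 0 < (volume {s | s ∈ T ∧ φ s > b}).toReal) :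
    ∃ s ∈ T, ∃ s' ∈ T, nrm (s - s') ≤ h ∧
      a / (2 * b) ≤ |(φ s - M s) - (φ s' - M s')| := by
  have hb0 : 0 < b := by linarith
  set q := a / b with hq
  have hq0 : 0 < q := by positivity
  have hqa : q ≤ a := div_le_self ha.le hb
  have hqb : q * b = a := div_mul_cancel₀ a hb0.ne'
  have hq2 : a / (2 * b) = q / 2 := by rw [hq]; field_simp
  have hγ : 0 < b - q := by linarith
  set W := z / (b - q) with hW
  have hW0 : 0 < W := by positivity
  rw [hq2]
  rcases lt_or_ge W 1 with hW1 | hW1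
  · have hne : {s | s ∈ T ∧ φ s > b}.Nonempty := by
      by_contra hemp
      rw [Set.not_nonempty_iff_eq_empty.1 hemp] at hpos
      simp at hpos
    obtain ⟨p, hp, hpb⟩ := hne
    obtain ⟨s, hs, hps, hsγ⟩ := exists_near_le_of_small_excursion hT (hball p hp) hsmall
    refine ⟨p, hp, s, hs, hps, le_trans ?_ (le_abs_self _)⟩
    have h1 := (abs_le.1 (hM p hp s hs hps)).2
    have h2 : H * (1 + (b - q + W)) ≤ 1 / 6 * q ^ 2 * (3 * b) := by
      apply mul_le_mul hH _ (by linarith) (by positivity)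
      linarith
    have h3 : 1 / 6 * q ^ 2 * (3 * b) = 1 / 2 * q * a := by rw [← hqb]; ring
    have h4 : 1 / 2 * q * a ≤ 1 / 2 * q := by nlinarith
    have h5 : φ p > b := hpb
    linarith
  · obtain ⟨s, hs, hps, hsγ⟩ := exists_near_le_of_small_excursion hT (hball t ht) hsmall
    refine ⟨t, ht, s, hs, hps, le_trans ?_ (le_abs_self _)⟩
    have h1 := (abs_le.1 (hM t ht s hs hps)).2
    have h2 : H * (1 + (b - q + W)) ≤ 1 / 6 * q ^ 2 * (2 * b + W) := by
      apply mul_le_mul hH _ (by linarith) (by positivity)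
      linarith
    have h3 : q ^ 2 * b = q * a := by rw [← hqb]; ring
    have h4 : q * a ≤ 1 / 2 * (1 / 2) := by
      apply mul_le_mul <;> linarith
    have h5 : q ^ 2 * W ≤ W := by
      have : q ^ 2 ≤ 1 := by nlinarith
      nlinarith
    linarith

/-- Proposition `PropTogether`.  Under Conditions A1–A4: for every
`v > 0` there exist `κ, λ₂ ∈ (0,∞)` such that for all `t ∈ T`, all sufficiently small
`a`, all `b ≥ 1`, all `z > 0`, and any realization `f̃` (on a probability space `Ω'`) of
the conditional law of `f` given `f(t) = x` (a Gaussian field with mean `μ̃` and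
covariance `C_g`, almost surely continuous on `T`), and all `y > 0` with
`y^{−β/d} ≤ a^{2+v}/(κ b^{2+v})`,
`P(m(Ã_γ)⁻¹ > y, m(Ã_b) > 0) ≤ exp(−λ₂ a² y^{β/d}/b²)`, where `γ = b − a/b`,
`x = γ + z/γ`, and `Ã_u = {s ∈ T : f̃(s) > u}`. -/
theorem conditional_field_small_excursion_probability
    {Ω : Type} [MeasureSpace Ω] [IsProbabilityMeasure (ℙ : Measure Ω)]
    {d : ℕ} (hd : 0 < d)
    (T : Set (Fin d → ℝ)) (hTcompact : IsCompact T) (h0T : (0 : Fin d → ℝ) ∈ T)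
    (f : (Fin d → ℝ) → Ω → ℝ) (hfmeas : ∀ t, Measurable (f t))
    -- `f` is a Gaussian random field on `T`
    (hGauss : ∀ (n : ℕ) (t : Fin n → (Fin d → ℝ)), (∀ i, t i ∈ T) →
      ∀ c : Fin n → ℝ, ∃ (m : ℝ) (v : NNReal),
        Measure.map (fun ω => ∑ i, c i * f (t i) ω) (ℙ : Measure Ω) = gaussianReal m v)
    -- mean, covariance and standard deviation functions
    (μ : (Fin d → ℝ) → ℝ) (C : (Fin d → ℝ) → (Fin d → ℝ) → ℝ) (σ : (Fin d → ℝ) → ℝ)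
    (hμ : ∀ t ∈ T, μ t = ∫ ω, f t ω)
    (hC : ∀ s ∈ T, ∀ t ∈ T, C s t = ∫ ω, (f s ω - μ s) * (f t ω - μ t))
    (hσ : ∀ t ∈ T, σ t = Real.sqrt (C t t)) (hσpos : ∀ t ∈ T, 0 < σ t)
    -- Condition A1: almost sure continuity on T
    (hA1 : ∀ᵐ ω ∂(ℙ : Measure Ω), ContinuousOn (fun t => f t ω) T)
    -- Conditions A2 and A3, with Hölder exponent `β` and constant `κH`
    (β κH δ : ℝ) (hβ : 0 < β) (hκH : 0 < κH) (hδ : 0 < δ)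
    (hA2 : ∀ s ∈ T, ∀ t ∈ T, nrm (s - t) < δ →
      |σ t - σ s| + |μ t - μ s| ≤ κH * nrm (s - t) ^ β)
    (hA3 : ∀ s ∈ T, ∀ s' ∈ T, ∀ t ∈ T, ∀ t' ∈ T,
      nrm (t - t') < δ → nrm (s - s') < δ →
      |C t s / (σ t * σ s) - C t' s' / (σ t' * σ s')| ≤
        κH * (nrm (t - t') ^ β + nrm (s - s') ^ β))
    -- Condition A4
    (κ₀ ε₁ : ℝ) (hκ₀ : 0 < κ₀) (hε₁ : 0 < ε₁)
    (hA4 : ∀ t ∈ T, ∀ ε : ℝ, 0 < ε → ε < ε₁ →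
      κ₀ * ε ^ d * (volume {x : Fin d → ℝ | nrm x ≤ 1}).toReal ≤
        (volume ({s | nrm (s - t) ≤ ε} ∩ T)).toReal)
    :
    ∀ v : ℝ, 0 < v →
      ∃ κ lam2 a₀ : ℝ, 0 < κ ∧ 0 < lam2 ∧ 0 < a₀ ∧
        ∀ t ∈ T, ∀ a : ℝ, 0 < a → a < a₀ → ∀ b : ℝ, 1 ≤ b → ∀ z : ℝ, 0 < z →
          ∀ (Ω' : Type) (_ : MeasureSpace Ω'),
            IsProbabilityMeasure (ℙ : Measure Ω') →
            ∀ ftld : (Fin d → ℝ) → Ω' → ℝ,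
              (∀ s, Measurable (ftld s)) →
              (∀ᵐ ω ∂(ℙ : Measure Ω'), ContinuousOn (fun s => ftld s ω) T) →
              -- `f̃` is a Gaussian field on `T` …
              (∀ (n : ℕ) (u : Fin n → (Fin d → ℝ)), (∀ i, u i ∈ T) →
                ∀ c : Fin n → ℝ, ∃ (m : ℝ) (w : NNReal),
                  Measure.map (fun ω => ∑ i, c i * ftld (u i) ω) (ℙ : Measure Ω') =
                    gaussianReal m w) →
              -- … with mean function `μ̃` …
              (∀ s ∈ T, (∫ ω, ftld s ω ∂(ℙ : Measure Ω')) =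
                condMean μ C σ t ((b - a / b) + z / (b - a / b)) s) →
              -- … and covariance function `C_g`
              (∀ s ∈ T, ∀ s' ∈ T,
                (∫ ω, (ftld s ω - condMean μ C σ t ((b - a / b) + z / (b - a / b)) s) *
                    (ftld s' ω - condMean μ C σ t ((b - a / b) + z / (b - a / b)) s')
                  ∂(ℙ : Measure Ω')) = condCov C σ t s s') →
              ∀ y : ℝ, 0 < y →
                y ^ (-(β / (d : ℝ))) ≤ a ^ (2 + v) / (κ * b ^ (2 + v)) →
                (ℙ {ω : Ω' |
                    (volume {s | s ∈ T ∧ ftld s ω > b - a / b}).toReal < y⁻¹ ∧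
                    0 < (volume {s | s ∈ T ∧ ftld s ω > b}).toReal}).toReal
                  ≤ Real.exp (-lam2 * a ^ 2 * y ^ (β / (d : ℝ)) / b ^ 2) := by
  intro v hv
  have hd' : (0 : ℝ) < d := by exact_mod_cast hd
  have hCσ : ∀ s ∈ T, C s s = σ s ^ 2 := by
    intro s hs
    have h0 := hσpos s hs
    rw [hσ s hs] at h0 ⊢
    exact (Real.sq_sqrt (Real.sqrt_pos.1 h0).le).symm
  have hσc : ContinuousOn σ T := continuousOn_of_holder hβ hδ (κ := κH) fun s hs t ht hst => by
    linarith [hA2 s hs t ht hst, abs_nonneg (μ t - μ s)]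
  have hμc : ContinuousOn μ T := continuousOn_of_holder hβ hδ (κ := κH) fun s hs t ht hst => by
    linarith [hA2 s hs t ht hst, abs_nonneg (σ t - σ s)]
  obtain ⟨S₁, hS₁⟩ := hTcompact.exists_bound_of_continuousOn hσc
  obtain ⟨S₂, hS₂⟩ := hTcompact.exists_bound_of_continuousOn hμc
  obtain ⟨t₁, ht₁, hmin⟩ := hTcompact.exists_isMinOn ⟨0, h0T⟩ hσc
  set S : ℝ := max S₁ S₂ with hS
  have hσS : ∀ s ∈ T, σ s ≤ S := fun s hs =>
    ((le_abs_self _).trans (hS₁ s hs)).trans (le_max_left _ _)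
  have hμS : ∀ s ∈ T, |μ s| ≤ S := fun s hs => (hS₂ s hs).trans (le_max_right _ _)
  have hS0 : 0 < S := (hσpos 0 h0T).trans_le (hσS 0 h0T)
  have hσm : 0 < σ t₁ := hσpos t₁ ht₁
  obtain ⟨K, hK, hnet⟩ := exists_net hd hTcompact.isBounded
  set V : ℝ := S * κH + 2 * S ^ 2 * κH with hV
  have hV0 : 0 < V := by positivity
  set K₂ : ℝ := κH + κH * (1 + S) ^ 2 / σ t₁ with hK₂
  have hK₂0 : 0 < K₂ := by positivity
  obtain ⟨A, c, Q₀, hA, hc, hQ₀, hmod⟩ := exists_modulus_tail δ hK hβ hV0 hnet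
  set ω₁ := (volume {x : Fin d → ℝ | nrm x ≤ 1}).toReal with hω₁
  have hω₁0 : 0 < ω₁ := volume_nrm_le_one_pos d
  set c₁ : ℝ := (κ₀ * ω₁) ^ (-1 / (d : ℝ)) with hc₁
  have hc₁0 : 0 < c₁ := by positivity
  set θ : ℝ := v / (2 + v) with hθ
  have hθ0 : 0 < θ := by positivity
  set lam2 : ℝ := c / (8 * c₁ ^ β) with hlam2
  have hlam0 : 0 < lam2 := by positivity
  have hh0 : Tendsto (fun Y : ℝ => c₁ * Y ^ (-(1 / β))) atTop (nhds 0) := by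
    simpa using (tendsto_rpow_neg_atTop (show 0 < 1 / β by positivity)).const_mul c₁
  have hev := ((((hh0.eventually (gt_mem_nhds one_pos)).and
    (hh0.eventually (gt_mem_nhds (show 0 < δ / 3 by positivity)))).and
    (hh0.eventually (gt_mem_nhds hε₁))).and
    (eventually_const_mul_rpow_le_exp (A := A * (c₁⁻¹ ^ d) ^ 2) (p := 2 * d / β) hlam0 hθ0)).and
    ((tendsto_rpow_atTop hθ0).eventually (eventually_ge_atTop (Q₀ * (4 * c₁ ^ β))))
  obtain ⟨Y₀, hY₀⟩ := eventually_atTop.1 hev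
  refine ⟨max (max 1 Y₀) (6 * K₂ * c₁ ^ β), lam2, 1 / 2, by positivity, hlam0, by norm_num, ?_⟩
  set κ : ℝ := max (max 1 Y₀) (6 * K₂ * c₁ ^ β) with hκ
  have hκ1 : 1 ≤ κ := (le_max_left _ _).trans (le_max_left _ _)
  have hκY : Y₀ ≤ κ := (le_max_right _ _).trans (le_max_left _ _)
  have hκK : 6 * K₂ * c₁ ^ β ≤ κ := le_max_right _ _
  intro t ht a ha ha2 b hb z hz Ω' mΩ' hP g hgmeas hgcont hgG hgM hgC y hy hyκ
  have hb0 : 0 < b := by linarith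
  set x : ℝ := (b - a / b) + z / (b - a / b) with hx
  set Y : ℝ := y ^ (β / (d : ℝ)) with hYdef
  have hY0 : 0 < Y := by positivity
  have hα0 : 0 < a / b := by positivity
  have hα1 : a / b ≤ 1 := (div_le_one hb0).2 (by linarith)
  have hYα : Y⁻¹ ≤ (a / b) ^ (2 + v) / κ := by
    rw [Real.rpow_neg hy.le] at hyκ
    refine hyκ.trans (le_of_eq ?_)
    rw [Real.div_rpow ha.le hb0.le, div_div, mul_comm κ]
  have hpow1 : (a / b) ^ (2 + v) ≤ (a / b) ^ 2 := by
    rw [← Real.rpow_ofNat]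
    exact Real.rpow_le_rpow_of_exponent_ge hα0 hα1 (by linarith)
  have hYκ : κ ≤ Y := by
    have h1 : Y⁻¹ ≤ κ⁻¹ := by
      refine hYα.trans ?_
      rw [div_eq_mul_inv]
      exact mul_le_of_le_one_left (by positivity) (Real.rpow_le_one hα0.le hα1 (by positivity))
    exact (inv_le_inv₀ hY0 (by linarith)).1 h1
  have hq : Y ^ θ ≤ (a / b) ^ 2 * Y := by
    refine rpow_le_sq_mul_of_inv_le hα0 hY0 hv (hYα.trans ?_)
    exact div_le_self (by positivity) hκ1
  set h : ℝ := c₁ * Y ^ (-(1 / β)) with hh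
  obtain ⟨⟨⟨⟨hh1, hhδ⟩, hhε⟩, hexp⟩, hQY⟩ := hY₀ Y (hκY.trans hYκ)
  have hhpos : 0 < h := by positivity
  have hhβ : h ^ β = c₁ ^ β * Y⁻¹ := by
    rw [hh, Real.mul_rpow hc₁0.le (by positivity), ← Real.rpow_mul hY0.le, neg_mul,
      one_div_mul_cancel hβ.ne', Real.rpow_neg_one]
  have hhd : κ₀ * h ^ d * ω₁ = y⁻¹ := by
    have e1 : c₁ ^ d = (κ₀ * ω₁)⁻¹ := by
      rw [hc₁, ← Real.rpow_natCast, ← Real.rpow_mul (by positivity), div_mul_cancel₀ _ hd'.ne',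
        Real.rpow_neg_one]
    have e2 : (Y ^ (-(1 / β))) ^ d = y⁻¹ := by
      rw [hYdef, ← Real.rpow_natCast, ← Real.rpow_mul hy.le, ← Real.rpow_mul hy.le,
        ← Real.rpow_neg_one]
      congr 1
      field_simp
    rw [hh, mul_pow, e1, e2]
    field_simp
  have hinv : (h⁻¹ ^ d) ^ 2 = (c₁⁻¹ ^ d) ^ 2 * Y ^ (2 * d / β) := by
    have e2 : ((Y ^ (-(1 / β)))⁻¹ ^ d) ^ 2 = Y ^ (2 * d / β) := by
      rw [← Real.rpow_neg hY0.le, neg_neg, ← pow_mul, ← Real.rpow_natCast, ← Real.rpow_mul hY0.le]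
      congr 1
      push_cast
      ring
    rw [hh, mul_inv, mul_pow, mul_pow, e2]
  set η : ℝ := a / (2 * b) with hη
  have hη0 : 0 < η := by positivity
  have hQ : η ^ 2 / h ^ β = (a / b) ^ 2 * Y / (4 * c₁ ^ β) := by
    rw [hhβ, hη]
    field_simp
    norm_num
  have hCt : ∀ s ∈ T, |C t s| ≤ σ t * σ s := by
    intro s hs
    have h1 : 0 ≤ condCov C σ t s s := by
      rw [← hgC s hs s hs]
      exact integral_nonneg fun ω => mul_self_nonneg _
    rw [condCov, hCσ s hs, sub_nonneg, div_le_iff₀ (pow_pos (hσpos t ht) 2)] at h1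
    refine abs_le_of_sq_le_sq ?_ (mul_pos (hσpos t ht) (hσpos s hs)).le
    rw [mul_pow, sq (C t s), mul_comm (σ t ^ 2)]
    exact h1
  have hMdiff : ∀ s ∈ T, ∀ s' ∈ T, nrm (s - s') < δ →
      |condMean μ C σ t x s - condMean μ C σ t x s'| ≤ K₂ * nrm (s - s') ^ β * (1 + x) := by
    intro s hs s' hs' hss
    have hx0 : 0 ≤ x := by
      have : 0 < b - a / b := by linarith [div_le_self ha.le hb]
      positivity
    have h1 := hA2 s' hs' s hs (by rwa [nrm_sub_comm])
    rw [nrm_sub_comm] at h1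
    have h2 := hA3 s hs s' hs' t ht t ht (by simpa [nrm] using hδ) hss
    rw [nrm_self_sub_rpow t hβ, zero_add] at h2
    have hn := nrm_nonneg (s - s')
    exact abs_condMean_sub_le hx0 hS0.le (by positivity) hσm (hmin ht) (hσpos s hs) (hσpos s' hs')
      (hσS s' hs') (hμS t ht) (hCt s hs) h1 h2
  have htail : ∀ s ∈ T, ∀ s' ∈ T, ∀ r : ℝ, 0 < r → r < δ → nrm (s - s') ≤ r → ∀ u : ℝ, 0 ≤ u →
      (ℙ : Measure Ω').real
        {ω | u ≤ |(g s ω - condMean μ C σ t x s) - (g s' ω - condMean μ C σ t x s')|} ≤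
        2 * Real.exp (-u ^ 2 / (2 * (V * r ^ β))) := by
    intro s hs s' hs' r hr hrδ hss u hu
    refine gaussian_increment_tail hgmeas hgG hgM hgC hs hs' (by positivity) ?_ hu
    refine (condCov_increment_le C σ t s s').trans ?_
    have hsδ : nrm (s - s') < δ := hss.trans_lt hrδ
    have hn : nrm (s - s') ^ β ≤ r ^ β := Real.rpow_le_rpow (nrm_nonneg _) hss hβ.le
    have h1 := hA2 s' hs' s hs (by rwa [nrm_sub_comm])
    rw [nrm_sub_comm] at h1
    have h2 := hA3 s hs s' hs' s hs s hs (by simpa [nrm] using hδ) hsδ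
    rw [nrm_self_sub_rpow s hβ, zero_add] at h2
    rw [hCσ s hs, ← sq, div_self (pow_pos (hσpos s hs) 2).ne'] at h2
    rw [hCσ s hs, hCσ s' hs']
    refine (increment_variance_le (hσpos s hs) (hσpos s' hs') (hσS s hs) (hσS s' hs') ?_ h2).trans
      (by gcongr)
    linarith [abs_nonneg (μ s - μ s')]
  have hMcont : ContinuousOn (condMean μ C σ t x) T :=
    continuousOn_of_holder hβ hδ (κ := K₂ * (1 + x)) fun s hs s' hs' hss => by
      rw [abs_sub_comm]
      refine (hMdiff s hs s' hs' hss).trans (le_of_eq ?_)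
      ring
  have hmodg := hmod Ω' _ ℙ hP (fun s ω => g s ω - condMean μ C σ t x s) h η hhpos hh1.le
    (by linarith) hη0
    (by
      rw [hQ, le_div_iff₀ (by positivity)]
      exact hQY.trans hq)
    htail (hgcont.mono fun ω hω => hω.sub hMcont)
  have hgt : ∀ᵐ ω ∂(ℙ : Measure Ω'), g t ω = x := by
    have hMt : condMean μ C σ t x t = x := by
      have := (hσpos t ht).ne'
      rw [condMean, hCσ t ht]
      field_simp
      ring
    have hCtt : condCov C σ t t t = 0 := by
      have := (hσpos t ht).ne'
      rw [condCov, hCσ t ht]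
      field_simp
      ring
    obtain ⟨m, w, hmw⟩ := hgG 1 (fun _ => t) (fun _ => ht) (fun _ => 1)
    simp only [Fin.sum_univ_one, one_mul] at hmw
    have h1 := hgC t ht t ht
    rw [hMt, hCtt] at h1
    exact ae_eq_of_centred_sq (memLp_two_of_gaussian (hgmeas t) hmw) h1
  have hH : K₂ * h ^ β ≤ 1 / 6 * (a / b) ^ 2 := by
    have h1 : 6 * K₂ * c₁ ^ β * Y⁻¹ ≤ (a / b) ^ 2 := by
      calc _ ≤ κ * ((a / b) ^ (2 + v) / κ) := by gcongr
        _ = (a / b) ^ (2 + v) := mul_div_cancel₀ _ (by positivity)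
        _ ≤ _ := hpow1
    rw [hhβ]
    linarith
  have hsub : (ℙ : Measure Ω').real {ω : Ω' |
        (volume {s | s ∈ T ∧ g s ω > b - a / b}).toReal < y⁻¹ ∧
        0 < (volume {s | s ∈ T ∧ g s ω > b}).toReal} ≤
      (ℙ : Measure Ω').real {ω | ∃ s ∈ T, ∃ s' ∈ T, nrm (s - s') ≤ h ∧
        η ≤ |(g s ω - condMean μ C σ t x s) - (g s' ω - condMean μ C σ t x s')|} := by
    refine ENNReal.toReal_mono (measure_ne_top _ _) (measure_mono_ae ?_)
    filter_upwards [hgt] with ω hω hmem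
    refine exists_fluctuation hTcompact ht (φ := fun s => g s ω) (w := y⁻¹) ha ha2.le hb hz
      hH hω ?_ ?_ hmem.1 hmem.2
    · intro s hs s' hs' hss
      have hx0 : 0 ≤ x := by
        have : 0 < b - a / b := by linarith [div_le_self ha.le hb]
        positivity
      refine (hMdiff s hs s' hs' (by linarith)).trans ?_
      have := nrm_nonneg (s - s')
      gcongr
    · intro p hp
      rw [← hhd]
      exact hA4 p hp h hhpos hhε
  refine (hsub.trans hmodg).trans ?_
  have e1 : -lam2 * a ^ 2 * Y / b ^ 2 = -(lam2 * ((a / b) ^ 2 * Y)) := by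
    field_simp
  have e2 : c * (η ^ 2 / h ^ β) = 2 * (lam2 * ((a / b) ^ 2 * Y)) := by
    rw [hQ, hlam2]
    field_simp
    norm_num
  have e3 : A * (h⁻¹ ^ d) ^ 2 ≤ Real.exp (lam2 * ((a / b) ^ 2 * Y)) := by
    rw [hinv, ← mul_assoc]
    exact hexp.trans (Real.exp_le_exp.2 (by gcongr))
  rw [e1, e2]
  calc _ ≤ Real.exp (lam2 * ((a / b) ^ 2 * Y)) * Real.exp (-(2 * (lam2 * ((a / b) ^ 2 * Y)))) := by
        gcongr
    _ = _ := by
        rw [← Real.exp_add]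
        congr 1
        ring
end
end

section
/- Assume Conditions A1–A4 with Hölder exponent β. For each v > 0 there exists a constant C(v) ∈ (0,∞), independent of b, such that P( max_{t∈T} f(t) > b ) ≤ C(v) · b^{2d/β + dv + 1} · max_{t∈T} P( f(t) > b ) for all b ≥ 1. -/
open MeasureTheory ProbabilityTheory Filter
open scoped Classical

noncomputable section

theorem measure_ge_le_exp_of_map_eq_gaussianReal {Ω : Type*} [MeasurableSpace Ω] {P : Measure Ω}
    [IsProbabilityMeasure P] {X : Ω → ℝ} {m : ℝ} {v : NNReal}
    (hX : P.map X = gaussianReal m v) (w : ℝ) :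
    P {ω | w ≤ X ω} ≤ ENNReal.ofReal (Real.exp (m - w + v / 2)) := by
  have hne : P.map X ≠ 0 := by rw [hX]; exact IsProbabilityMeasure.ne_zero _
  have hm : AEMeasurable X P := by
    by_contra h
    exact hne (Measure.map_of_not_aemeasurable h)
  have hmgf := mgf_gaussianReal hX 1
  have hint : Integrable (fun ω => Real.exp (1 * X ω)) P := by
    by_contra h
    have := integral_undef h
    rw [mgf, this] at hmgf
    exact (Real.exp_pos _).ne hmgf
  have h := measure_ge_le_exp_mul_mgf w zero_le_one hint
  rw [hmgf, ← Real.exp_add] at h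
  rw [← ENNReal.ofReal_toReal (measure_ne_top P {ω | w ≤ X ω})]
  refine ENNReal.ofReal_le_ofReal (h.trans (Real.exp_le_exp.2 ?_))
  ring_nf
  rfl

/-- Lower bound of Mills type for the standard Gaussian tail. -/
theorem exists_le_gaussianReal_Ioi : ∃ c : ℝ, 0 < c ∧ ∀ u : ℝ, 1 ≤ u →
    c * (u⁻¹ * Real.exp (-u ^ 2 / 2)) ≤ (gaussianReal 0 1).real (Set.Ioi u) := by
  refine ⟨(√(2 * Real.pi))⁻¹ * Real.exp (-3 / 2), by positivity, fun u hu => ?_⟩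
  have hu0 : 0 < u := by linarith
  have hsub : Set.Ioc u (u + u⁻¹) ⊆ Set.Ioi u := Set.Ioc_subset_Ioi_self
  refine le_trans ?_ (measureReal_mono hsub)
  rw [measureReal_def, gaussianReal_apply_eq_integral 0 one_ne_zero,
    ENNReal.toReal_ofReal (integral_nonneg fun x => gaussianPDFReal_nonneg _ _ _)]
  have hvol : (volume : Measure ℝ).real (Set.Ioc u (u + u⁻¹)) = u⁻¹ := by
    rw [Measure.real, Real.volume_Ioc, add_sub_cancel_left, ENNReal.toReal_ofReal (by positivity)]
  have := setIntegral_ge_of_const_le_real (μ := volume) (s := Set.Ioc u (u + u⁻¹))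
    (f := gaussianPDFReal 0 1) (c := (√(2 * Real.pi))⁻¹ * Real.exp (-3 / 2) * Real.exp (-u ^ 2 / 2))
    measurableSet_Ioc (by simp) (fun x hx => ?_) (integrable_gaussianPDFReal 0 1).integrableOn
  · rw [hvol] at this
    refine le_trans (le_of_eq ?_) this
    ring
  · rw [gaussianPDFReal, mul_assoc, ← Real.exp_add]
    simp only [NNReal.coe_one, mul_one, sub_zero]
    gcongr
    have h1 : x ^ 2 ≤ (u + u⁻¹) ^ 2 := by
      exact pow_le_pow_left₀ (hu0.le.trans hx.1.le) hx.2 2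
    have h2 : u⁻¹ ≤ 1 := inv_le_one_of_one_le₀ hu
    have h3 : (u + u⁻¹) ^ 2 = u ^ 2 + 2 + u⁻¹ ^ 2 := by field_simp; ring
    have h4 : u⁻¹ ^ 2 ≤ 1 := pow_le_one₀ (by positivity) h2
    linarith

theorem exists_finset_net {d : ℕ} {T : Set (Fin d → ℝ)} (hT : Bornology.IsBounded T) :
    ∃ A : ℝ, 0 < A ∧ ∀ ε : ℝ, 0 < ε → ε ≤ 1 → ∃ N : Finset (Fin d → ℝ),
      (∀ s ∈ N, s ∈ T) ∧ (∀ t ∈ T, ∃ s ∈ N, dist s t ≤ ε) ∧ (N.card : ℝ) ≤ (A / ε) ^ d := by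
  obtain ⟨M, hM0, hM⟩ := hT.exists_pos_norm_le
  refine ⟨2 * M + 3, by positivity, fun ε hε hε1 => ?_⟩
  let cell : (Fin d → ℝ) → Fin d → ℤ := fun t i => ⌊t i / ε⌋
  let box : Finset (Fin d → ℤ) := Fintype.piFinset fun _ => Finset.Icc (-⌈M / ε⌉) ⌈M / ε⌉
  have hbox : ∀ t ∈ T, cell t ∈ box := by
    intro t ht
    refine Fintype.mem_piFinset.2 fun i => Finset.mem_Icc.2 ?_
    have h1 : |t i| ≤ M := (norm_le_pi_norm t i).trans (hM t ht)
    obtain ⟨h2, h3⟩ := abs_le.1 h1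
    have h4 := Int.le_ceil (M / ε)
    constructor
    · refine Int.le_floor.2 ?_
      have : -(M / ε) ≤ t i / ε := by rw [← neg_div]; gcongr
      push_cast
      linarith
    · refine Int.cast_le (R := ℝ).1 ((Int.floor_le _).trans (le_trans ?_ h4))
      gcongr
  choose! rep hrep using fun k (hk : k ∈ cell '' T) => hk
  refine ⟨(box.filter (· ∈ cell '' T)).image rep, ?_, fun t ht => ⟨rep (cell t), ?_, ?_⟩, ?_⟩
  · intro s hs
    obtain ⟨k, hk, rfl⟩ := Finset.mem_image.1 hs
    exact (hrep k (Finset.mem_filter.1 hk).2).1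
  · exact Finset.mem_image_of_mem _ (Finset.mem_filter.2 ⟨hbox t ht, t, ht, rfl⟩)
  · have h := (hrep (cell t) ⟨t, ht, rfl⟩).2
    refine (dist_pi_le_iff hε.le).2 fun i => ?_
    have h1 := Int.abs_sub_lt_one_of_floor_eq_floor (congrFun h i)
    rw [Real.dist_eq]
    rw [← sub_div, abs_div, abs_of_pos hε, div_lt_one hε] at h1
    exact h1.le
  · have h1 : ((box.filter (· ∈ cell '' T)).image rep).card ≤ box.card :=
      Finset.card_image_le.trans (Finset.card_filter_le _ _)
    have h0 : 0 ≤ ⌈M / ε⌉ := Int.ceil_nonneg (by positivity)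
    have h2 : (box.card : ℝ) = (2 * (⌈M / ε⌉ : ℝ) + 1) ^ d := by
      simp only [box, Fintype.card_piFinset, Int.card_Icc, Finset.prod_const, Finset.card_univ,
        Fintype.card_fin, Nat.cast_pow]
      congr 1
      rw [← Int.cast_natCast, Int.toNat_of_nonneg (by linarith)]
      push_cast
      ring
    refine (Nat.cast_le.2 h1).trans (h2.le.trans ?_)
    have h0' : (0 : ℝ) ≤ ⌈M / ε⌉ := by exact_mod_cast h0
    gcongr
    have h3 := (Int.ceil_lt_add_one (M / ε)).le
    rw [add_div, mul_div_assoc]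
    have : 3 ≤ 3 / ε := by rw [le_div_iff₀ hε]; linarith
    linarith

theorem summable_pow_mul_exp_neg_pow {a x c : ℝ} (ha : 0 ≤ a) (hx : 1 < x) (hc : 0 < c) :
    Summable fun n : ℕ => a ^ n * Real.exp (-(c * x ^ n)) := by
  obtain ⟨k, hk⟩ := pow_unbounded_of_one_lt (2 * a) hx
  have hx0 : 0 < x := by linarith
  have hr : a / x ^ k < 1 := by
    rw [div_lt_one (by positivity)]
    linarith
  have hs := (summable_geometric_of_lt_one (by positivity) hr).mul_left ((k.factorial : ℝ) / c ^ k)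
  refine Summable.of_nonneg_of_le (fun n => by positivity) (fun n => ?_) hs
  have h1 : (c * x ^ n) ^ k / k.factorial ≤ Real.exp (c * x ^ n) :=
    Real.pow_div_factorial_le_exp _ (by positivity) k
  rw [Real.exp_neg]
  calc a ^ n * (Real.exp (c * x ^ n))⁻¹ ≤ a ^ n * ((c * x ^ n) ^ k / k.factorial)⁻¹ := by gcongr
    _ = _ := by
      rw [div_pow, mul_pow, ← pow_mul, ← pow_mul, mul_comm n k]
      field_simp

theorem exists_measure_exists_gt_le {Ω : Type*} [MeasurableSpace Ω] (P : Measure Ω)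
    {d : ℕ} {T : Set (Fin d → ℝ)} (hT : Bornology.IsBounded T) (g : (Fin d → ℝ) → Ω → ℝ)
    (hcont : ∀ᵐ ω ∂P, ContinuousOn (fun t => g t ω) T)
    {K β δ : ℝ} (hK : 0 < K) (hβ : 0 < β) (hδ : 0 < δ)
    (hg : ∀ s ∈ T, ∀ t ∈ T, dist s t < δ → ∀ l θ w : ℝ, 0 ≤ l → 0 ≤ θ →
      P {ω | w ≤ l * g t ω + θ * (g t ω - g s ω)} ≤
        ENNReal.ofReal (Real.exp (-w + l ^ 2 / 2 + (l * θ + θ ^ 2) * (K * dist s t ^ β)))) :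
    ∃ B : ℝ, 0 < B ∧ ∀ u : ℝ, 1 ≤ u → P {ω | ∃ t ∈ T, u < g t ω} ≤
      ENNReal.ofReal (B * (u ^ (2 * (d : ℝ) / β) * Real.exp (-u ^ 2 / 2))) := by
  obtain ⟨A, hA, hnet⟩ := exists_finset_net hT
  choose! N hNT hNnear hNcard using hnet
  choose! π hπN hπdist using hNnear
  obtain ⟨c, hc, hc1, hcδ, hcK⟩ : ∃ c : ℝ, 0 < c ∧ c ≤ 1 ∧ c < δ ∧ K * c ^ β ≤ 1 / 2 := by
    refine ⟨min (min 1 (δ / 2)) ((1 / (2 * K)) ^ β⁻¹), by positivity, ?_, ?_, ?_⟩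
    · exact (min_le_left _ _).trans (min_le_left _ _)
    · exact ((min_le_left _ _).trans (min_le_right _ _)).trans_lt (by linarith)
    · have h : (min (min 1 (δ / 2)) ((1 / (2 * K)) ^ β⁻¹)) ^ β ≤ 1 / (2 * K) := by
        refine (Real.rpow_le_rpow (by positivity) (min_le_right _ _) hβ.le).trans (le_of_eq ?_)
        rw [← Real.rpow_mul (by positivity), inv_mul_cancel₀ hβ.ne', Real.rpow_one]
      calc _ ≤ K * (1 / (2 * K)) := by gcongr
        _ = 1 / 2 := by field_simp
  set q : ℝ := (1 / 2 : ℝ) ^ (β / 4) with hq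
  have hq0 : 0 < q := by positivity
  have hq1 : q < 1 := Real.rpow_lt_one (by norm_num) (by norm_num) (by positivity)
  have h1q : 0 < 1 - q := by linarith
  have hq4 : (1 / 2 : ℝ) ^ β = q ^ 4 := by
    rw [hq, ← Real.rpow_natCast, ← Real.rpow_mul (by norm_num)]
    congr 1
    push_cast
    ring
  have hsum : Summable fun n : ℕ =>
      (2 ^ d : ℝ) ^ (n + 1) * Real.exp (-(1 / 8 * (q⁻¹ ^ 2) ^ n)) := by
    have h := summable_pow_mul_exp_neg_pow (a := 2 ^ d) (x := q⁻¹ ^ 2) (c := 1 / 8)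
      (by positivity) (one_lt_pow₀ ((one_lt_inv₀ hq0).2 hq1) two_ne_zero) (by norm_num)
    refine (h.mul_left (2 ^ d : ℝ)).congr fun n => ?_
    ring
  set S : ℝ := ∑' n : ℕ, (2 ^ d : ℝ) ^ (n + 1) * Real.exp (-(1 / 8 * (q⁻¹ ^ 2) ^ n))
  have hS0 : 0 ≤ S := tsum_nonneg fun n => by positivity
  refine ⟨(A / c) ^ d * Real.exp (1 / (1 - q)) * (1 + S), by positivity, fun u hu => ?_⟩
  have hu0 : 0 < u := by linarith
  set ε : ℕ → ℝ := fun n => c * u ^ (-(2 / β)) * (1 / 2) ^ n with hε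
  have hε0 : ∀ n, 0 < ε n := fun n => by positivity
  have hupow : u ^ (-(2 / β)) ≤ 1 :=
    Real.rpow_le_one_of_one_le_of_nonpos hu (by rw [neg_nonpos]; positivity)
  have hεc : ∀ n, ε n ≤ c := fun n => by
    calc ε n ≤ c * 1 * 1 := by
          simp only [hε]
          gcongr
          exact pow_le_one₀ (by norm_num) (by norm_num)
      _ = c := by ring
  have hε1 : ∀ n, ε n ≤ 1 := fun n => (hεc n).trans hc1
  have hεK : ∀ n, K * ε n ^ β ≤ (q ^ n) ^ 4 / (2 * u ^ 2) := fun n => by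
    have h1 : (u ^ (-(2 / β))) ^ β = (u ^ 2)⁻¹ := by
      rw [← Real.rpow_mul hu0.le, show -(2 / β) * β = -((2 : ℕ) : ℝ) by
        rw [neg_mul, div_mul_cancel₀ _ hβ.ne']; norm_num, Real.rpow_neg hu0.le,
        Real.rpow_natCast]
    have h2 : (((1 : ℝ) / 2) ^ n) ^ β = (q ^ n) ^ 4 := by
      rw [← Real.rpow_pow_comm (by norm_num), hq4, ← pow_mul, ← pow_mul, mul_comm]
    simp only [hε]
    rw [Real.mul_rpow (by positivity) (by positivity), Real.mul_rpow hc.le (by positivity), h1, h2]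
    calc _ = (K * c ^ β) * ((u ^ 2)⁻¹ * (q ^ n) ^ 4) := by ring
      _ ≤ 1 / 2 * ((u ^ 2)⁻¹ * (q ^ n) ^ 4) := by gcongr
      _ = _ := by field_simp
  set D : ℝ := (A / c) ^ d * u ^ (2 * (d : ℝ) / β) with hD
  have hcard : ∀ n, ((N (ε n)).card : ℝ) ≤ D * (2 ^ d) ^ n := fun n => by
    refine (hNcard _ (hε0 n) (hε1 n)).trans (le_of_eq ?_)
    have h1 : A / ε n = A / c * u ^ (2 / β) * 2 ^ n := by
      simp only [hε]
      rw [Real.rpow_neg hu0.le, one_div, inv_pow]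
      field_simp
    rw [h1, mul_pow, mul_pow, ← Real.rpow_natCast (u ^ (2 / β)), ← Real.rpow_mul hu0.le, ← pow_mul,
      ← pow_mul, mul_comm n d, hD]
    congr 3
    ring
  set E : ℝ := Real.exp (1 / (1 - q)) * Real.exp (-u ^ 2 / 2) with hE
  set a : ℕ → ℝ := fun n => u - q ^ n / ((1 - q) * u) with ha
  have hua : ∀ n, u ^ 2 - 1 / (1 - q) ≤ u * a n := fun n => by
    have h1 : u * a n = u ^ 2 - q ^ n / (1 - q) := by
      simp only [ha]
      field_simp
    have h2 : q ^ n / (1 - q) ≤ 1 / (1 - q) := by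
      gcongr
      exact pow_le_one₀ hq0.le hq1.le
    linarith
  have hau : ∀ n, a n ≤ u := fun n => by
    have : 0 ≤ q ^ n / ((1 - q) * u) := by positivity
    simp only [ha]
    linarith
  have hstep : ∀ n, a (n + 1) - a n = q ^ n / u := fun n => by
    simp only [ha]
    field_simp
    ring
  have hfin : ∀ (n : ℕ) (V : (Fin d → ℝ) → Set Ω) (x : ℝ), 0 ≤ x →
      (∀ t ∈ N (ε n), P (V t) ≤ ENNReal.ofReal x) →
      P (⋃ t ∈ N (ε n), V t) ≤ ENNReal.ofReal (D * (2 ^ d) ^ n * x) := by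
    intro n V x hx hV
    refine (measure_biUnion_finset_le _ _).trans ((Finset.sum_le_card_nsmul _ _ _ hV).trans ?_)
    rw [nsmul_eq_mul, ← ENNReal.ofReal_natCast, ← ENNReal.ofReal_mul (by positivity)]
    exact ENNReal.ofReal_le_ofReal (mul_le_mul_of_nonneg_right (hcard n) hx)
  have hstart : P (⋃ t ∈ N (ε 0), {ω | a 0 < g t ω}) ≤ ENNReal.ofReal (D * E) := by
    have h := hfin 0 (fun t => {ω | a 0 < g t ω}) E (by positivity) fun t ht => by
      have htT := hNT _ (hε0 0) (hε1 0) t ht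
      have h := hg t htT t htT (by simpa using hδ) u 0 (u * a 0) hu0.le le_rfl
      refine le_trans (measure_mono fun ω hω => ?_) (h.trans (ENNReal.ofReal_le_ofReal ?_))
      · simp only [Set.mem_ofPred_eq, zero_mul, add_zero] at hω ⊢
        gcongr
      · rw [hE, ← Real.exp_add]
        refine Real.exp_le_exp.2 ?_
        have := hua 0
        simp only [mul_zero, ne_eq, OfNat.ofNat_ne_zero, not_false_eq_true, zero_pow, add_zero,
          zero_mul]
        linarith
    simpa using h
  have hcross : ∀ n, P (⋃ t ∈ N (ε (n + 1)), {ω | a (n + 1) < g t ω ∧ g (π (ε n) t) ω ≤ a n}) ≤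
      ENNReal.ofReal (D * E * ((2 ^ d : ℝ) ^ (n + 1) *
        Real.exp (-(1 / 8 * (q⁻¹ ^ 2) ^ n)))) := fun n => by
    have h := hfin (n + 1) (fun t => {ω | a (n + 1) < g t ω ∧ g (π (ε n) t) ω ≤ a n})
      (E * Real.exp (-(1 / 8 * (q⁻¹ ^ 2) ^ n))) (by positivity) fun t ht => by
      have htT := hNT _ (hε0 _) (hε1 _) t ht
      have hsN := hπN _ (hε0 n) (hε1 n) t htT
      have hsT := hNT _ (hε0 n) (hε1 n) _ hsN
      have hst := hπdist _ (hε0 n) (hε1 n) t htT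
      set s := π (ε n) t
      set x := q ^ n with hx
      have hx0 : 0 < x := by positivity
      have hx1 : x ≤ 1 := pow_le_one₀ hq0.le hq1.le
      have hθ : 0 ≤ u / (2 * x ^ 3) := by positivity
      have h := hg s hsT t htT (hst.trans_lt ((hεc n).trans_lt hcδ)) u (u / (2 * x ^ 3))
        (u * a (n + 1) + u / (2 * x ^ 3) * (x / u)) hu0.le hθ
      refine le_trans (measure_mono fun ω hω => ?_) (h.trans (ENNReal.ofReal_le_ofReal ?_))
      · obtain ⟨h1, h2⟩ := hω
        have h3 : x / u ≤ g t ω - g s ω := by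
          rw [hx, ← hstep n]
          linarith
        simp only [Set.mem_ofPred_eq]
        gcongr
      · rw [hE, ← Real.exp_add, ← Real.exp_add]
        refine Real.exp_le_exp.2 ?_
        have h1 : K * dist s t ^ β ≤ x ^ 4 / (2 * u ^ 2) := by
          refine le_trans ?_ (hεK n)
          gcongr
        have h2 : (u * (u / (2 * x ^ 3)) + (u / (2 * x ^ 3)) ^ 2) * (K * dist s t ^ β) ≤
            x / 4 + (x⁻¹) ^ 2 / 8 := by
          calc _ ≤ (u * (u / (2 * x ^ 3)) + (u / (2 * x ^ 3)) ^ 2) * (x ^ 4 / (2 * u ^ 2)) := by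
                gcongr
            _ = _ := by
              field_simp
              ring
        have h3 : u / (2 * x ^ 3) * (x / u) = (x⁻¹) ^ 2 / 2 := by field_simp
        have h4 : (q⁻¹ ^ 2) ^ n = (x⁻¹) ^ 2 := by
          rw [hx, ← inv_pow, ← pow_mul, ← pow_mul, mul_comm]
        have h5 : 1 ≤ (x⁻¹) ^ 2 := one_le_pow₀ ((one_le_inv₀ hx0).2 hx1)
        have h6 := hua (n + 1)
        rw [h3, h4]
        linarith
    refine h.trans (ENNReal.ofReal_le_ofReal (le_of_eq ?_))
    ring
  have hcover : P {ω | ∃ t ∈ T, u < g t ω} ≤ P ((⋃ t ∈ N (ε 0), {ω | a 0 < g t ω}) ∪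
      ⋃ n, ⋃ t ∈ N (ε (n + 1)), {ω | a (n + 1) < g t ω ∧ g (π (ε n) t) ω ≤ a n}) := by
    refine measure_mono_ae ?_
    filter_upwards [hcont] with ω hω
    rintro ⟨t, ht, hut⟩
    by_contra hnot
    have hnot' : ¬ ((∃ s ∈ N (ε 0), a 0 < g s ω) ∨ ∃ n, ∃ s ∈ N (ε (n + 1)),
        a (n + 1) < g s ω ∧ g (π (ε n) s) ω ≤ a n) := by
      intro h
      refine hnot (show ω ∈ (_ ∪ _ : Set Ω) from ?_)
      simp only [Set.mem_union, Set.mem_iUnion, exists_prop]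
      exact h
    push Not at hnot'
    have hle : ∀ n, ∀ s ∈ N (ε n), g s ω ≤ a n := by
      intro n
      induction n with
      | zero => exact hnot'.1
      | succ n ih =>
        intro s hs
        by_contra! hlt
        have hsT := hNT _ (hε0 _) (hε1 _) s hs
        exact (hnot'.2 n s hs hlt).not_ge (ih _ (hπN _ (hε0 n) (hε1 n) s hsT))
    have hlim : Tendsto (fun n => π (ε n) t) atTop (nhdsWithin t T) := by
      refine tendsto_nhdsWithin_iff.2 ⟨?_, Eventually.of_forall fun n =>
        hNT _ (hε0 n) (hε1 n) _ (hπN _ (hε0 n) (hε1 n) t ht)⟩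
      refine tendsto_iff_dist_tendsto_zero.2 (squeeze_zero (fun _ => dist_nonneg)
        (fun n => hπdist _ (hε0 n) (hε1 n) t ht) ?_)
      have := (tendsto_pow_atTop_nhds_zero_of_lt_one (r := (1 / 2 : ℝ)) (by norm_num)
        (by norm_num)).const_mul (c * u ^ (-(2 / β)))
      simpa [hε] using this
    have hgt : g t ω ≤ u := le_of_tendsto ((hω t ht).tendsto.comp hlim)
      (Eventually.of_forall fun n =>
        (hle n _ (hπN _ (hε0 n) (hε1 n) t ht)).trans (hau n))
    exact hgt.not_gt hut
  have hDE : 0 ≤ D * E := by positivity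
  calc P {ω | ∃ t ∈ T, u < g t ω} ≤ _ := hcover
    _ ≤ ENNReal.ofReal (D * E) + ∑' n : ℕ, ENNReal.ofReal (D * E * ((2 ^ d : ℝ) ^ (n + 1) *
        Real.exp (-(1 / 8 * (q⁻¹ ^ 2) ^ n)))) :=
      (measure_union_le _ _).trans (add_le_add hstart
        ((measure_iUnion_le _).trans (ENNReal.tsum_le_tsum hcross)))
    _ = ENNReal.ofReal (D * E + D * E * S) := by
      rw [← ENNReal.ofReal_tsum_of_nonneg (fun n => by positivity) (hsum.mul_left _),
        tsum_mul_left, ENNReal.ofReal_add hDE (by positivity)]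
    _ = _ := by
      congr 1
      simp only [hD, hE]
      ring

theorem gaussianReal_mean_variance_of_map_linear_combination {Ω : Type*} [MeasurableSpace Ω]
    {P : Measure Ω} [IsProbabilityMeasure P] {X Y : Ω → ℝ} (hX : MemLp X 2 P) (hY : MemLp Y 2 P)
    {α γ m : ℝ} {v : NNReal} (h : P.map (fun ω => α * X ω + γ * Y ω) = gaussianReal m v) :
    m = α * (∫ ω, X ω ∂P) + γ * (∫ ω, Y ω ∂P) ∧
    (v : ℝ) = α ^ 2 * cov[X, X; P] + 2 * (α * γ) * cov[X, Y; P] + γ ^ 2 * cov[Y, Y; P] := by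
  have hXi := hX.integrable one_le_two
  have hYi := hY.integrable one_le_two
  have hZ : MemLp (fun ω => α * X ω + γ * Y ω) 2 P := (hX.const_mul α).add (hY.const_mul γ)
  have hZm := hZ.aestronglyMeasurable.aemeasurable
  constructor
  · have h1 := integral_id_gaussianReal (μ := m) (v := v)
    rw [← h, integral_map hZm measurable_id'.aestronglyMeasurable, integral_add (hXi.const_mul α)
      (hYi.const_mul γ), integral_const_mul, integral_const_mul] at h1
    exact h1.symm
  · have h1 := variance_fun_id_gaussianReal (μ := m) (v := v)
    rw [← h, variance_map aemeasurable_id' hZm] at h1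
    have h2 := variance_fun_add (hX.const_mul α) (hY.const_mul γ)
    rw [← h1]
    refine h2.trans ?_
    rw [variance_const_mul, variance_const_mul, covariance_const_mul_left,
      covariance_const_mul_right, covariance_self hX.aestronglyMeasurable.aemeasurable,
      covariance_self hY.aestronglyMeasurable.aemeasurable]
    ring

theorem gaussianReal_real_Ioi_add (m u : ℝ) :
    (gaussianReal m 1).real (Set.Ioi (m + u)) = (gaussianReal 0 1).real (Set.Ioi u) := by
  have h := gaussianReal_map_const_add (μ := 0) (v := 1) m
  rw [zero_add] at h
  rw [← h, map_measureReal_apply (measurable_const_add m) measurableSet_Ioi]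
  congr 1
  ext x
  simp

theorem continuousOn_of_abs_sub_le_rpow {E : Type*} [PseudoMetricSpace E] {T : Set E} {φ : E → ℝ}
    {K β δ : ℝ} (hβ : 0 < β) (hδ : 0 < δ)
    (h : ∀ s ∈ T, ∀ t ∈ T, dist s t < δ → |φ t - φ s| ≤ K * dist s t ^ β) :
    ContinuousOn φ T := by
  intro t ht
  refine tendsto_iff_dist_tendsto_zero.2 ?_
  have h0 : Tendsto (fun s => K * dist t s ^ β) (nhdsWithin t T) (nhds 0) := by
    have h1 : Tendsto (fun s => dist t s) (nhdsWithin t T) (nhds 0) := by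
      have : Tendsto (fun s => dist t s) (nhds t) (nhds (dist t t)) :=
        (continuous_const.dist continuous_id).tendsto t
      rw [dist_self] at this
      exact this.mono_left nhdsWithin_le_nhds
    have h2 := (h1.rpow_const (p := β) (Or.inr hβ.le)).const_mul K
    rwa [Real.zero_rpow hβ.ne', mul_zero] at h2
  refine squeeze_zero' (Eventually.of_forall fun _ => dist_nonneg) ?_ h0
  filter_upwards [self_mem_nhdsWithin, mem_nhdsWithin_of_mem_nhds (Metric.ball_mem_nhds t hδ)]
    with s hs hst
  rw [Real.dist_eq]
  exact h t ht s hs (by rwa [dist_comm])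

theorem nrm_sub_le_mul_dist {d : ℕ} (s t : Fin d → ℝ) : nrm (s - t) ≤ d * dist s t := by
  have h : ∀ j ∈ Finset.univ, |(s - t) j| ≤ dist s t := fun j _ => by
    rw [dist_eq_norm]
    exact norm_le_pi_norm (s - t) j
  simpa [nrm] using Finset.sum_le_card_nsmul _ _ _ h

/-- Lemma `LemBndDens1`.  Under Conditions A1–A4 with Hölder exponent
`β`: for each `v > 0` there is a constant `C(v) ∈ (0,∞)`, independent of `b`, such that
`P(max_{t∈T} f(t) > b) ≤ C(v) b^{2d/β + dv + 1} max_{t∈T} P(f(t) > b)` for all `b ≥ 1`. -/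
theorem tail_of_max_bounded_by_pointwise_tail
    {Ω : Type} [MeasureSpace Ω] [IsProbabilityMeasure (ℙ : Measure Ω)]
    {d : ℕ} (hd : 0 < d)
    (T : Set (Fin d → ℝ)) (hTcompact : IsCompact T) (h0T : (0 : Fin d → ℝ) ∈ T)
    (f : (Fin d → ℝ) → Ω → ℝ) (hfmeas : ∀ t, Measurable (f t))
    -- `f` is a Gaussian random field on `T`
    (hGauss : ∀ (n : ℕ) (t : Fin n → (Fin d → ℝ)), (∀ i, t i ∈ T) →
      ∀ c : Fin n → ℝ, ∃ (m : ℝ) (v : NNReal),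
        Measure.map (fun ω => ∑ i, c i * f (t i) ω) (ℙ : Measure Ω) = gaussianReal m v)
    -- mean, covariance and standard deviation functions
    (μ : (Fin d → ℝ) → ℝ) (C : (Fin d → ℝ) → (Fin d → ℝ) → ℝ) (σ : (Fin d → ℝ) → ℝ)
    (hμ : ∀ t ∈ T, μ t = ∫ ω, f t ω)
    (hC : ∀ s ∈ T, ∀ t ∈ T, C s t = ∫ ω, (f s ω - μ s) * (f t ω - μ t))
    (hσ : ∀ t ∈ T, σ t = Real.sqrt (C t t)) (hσpos : ∀ t ∈ T, 0 < σ t)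
    -- Condition A1: almost sure continuity on T
    (hA1 : ∀ᵐ ω ∂(ℙ : Measure Ω), ContinuousOn (fun t => f t ω) T)
    -- Conditions A2 and A3, with Hölder exponent `β` and constant `κH`
    (β κH δ : ℝ) (hβ : 0 < β) (hκH : 0 < κH) (hδ : 0 < δ)
    (hA2 : ∀ s ∈ T, ∀ t ∈ T, nrm (s - t) < δ →
      |σ t - σ s| + |μ t - μ s| ≤ κH * nrm (s - t) ^ β)
    (hA3 : ∀ s ∈ T, ∀ s' ∈ T, ∀ t ∈ T, ∀ t' ∈ T,
      nrm (t - t') < δ → nrm (s - s') < δ →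
      |C t s / (σ t * σ s) - C t' s' / (σ t' * σ s')| ≤
        κH * (nrm (t - t') ^ β + nrm (s - s') ^ β))
    -- Condition A4
    (κ₀ ε₁ : ℝ) (hκ₀ : 0 < κ₀) (hε₁ : 0 < ε₁)
    (hA4 : ∀ t ∈ T, ∀ ε : ℝ, 0 < ε → ε < ε₁ →
      κ₀ * ε ^ d * (volume {x : Fin d → ℝ | nrm x ≤ 1}).toReal ≤
        (volume ({s | nrm (s - t) ≤ ε} ∩ T)).toReal)
    :
    ∀ v : ℝ, 0 < v →
      ∃ Cv : ℝ, 0 < Cv ∧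
        ∀ b : ℝ, 1 ≤ b →
          (ℙ {ω | ∃ t ∈ T, f t ω > b}).toReal
            ≤ Cv * b ^ (2 * (d : ℝ) / β + (d : ℝ) * v + 1) *
                sSup ((fun t => (ℙ {ω | f t ω > b}).toReal) '' T) := by
  intro v hv
  have hd' : (0 : ℝ) < d := by exact_mod_cast hd
  have hlaw : ∀ s ∈ T, ∀ t ∈ T, ∀ α γ : ℝ, ∃ (m : ℝ) (w : NNReal),
      Measure.map (fun ω => α * f t ω + γ * f s ω) (ℙ : Measure Ω) = gaussianReal m w := by
    intro s hs t ht α γ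
    have h := hGauss 2 ![t, s] (by simp [Fin.forall_fin_two, hs, ht]) ![α, γ]
    simpa [Fin.sum_univ_two] using h
  have hLp : ∀ t ∈ T, MemLp (f t) 2 (ℙ : Measure Ω) := by
    intro t ht
    obtain ⟨m, w, h⟩ := hlaw t ht t ht 1 0
    simp only [one_mul, zero_mul, add_zero] at h
    have h2 := memLp_id_gaussianReal (μ := m) (v := w) 2
    rw [← h] at h2
    exact (memLp_map_measure_iff aestronglyMeasurable_id (hfmeas t).aemeasurable).1 h2
  have hcov : ∀ s ∈ T, ∀ t ∈ T, cov[f s, f t; ℙ] = C s t := by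
    intro s hs t ht
    rw [hC s hs t ht, hμ s hs, hμ t ht]
    rfl
  have hσsq : ∀ t ∈ T, C t t = σ t ^ 2 := by
    intro t ht
    have h := hσpos t ht
    rw [hσ t ht] at h ⊢
    rw [Real.sq_sqrt (Real.sqrt_pos.1 h).le]
  have hparam : ∀ s ∈ T, ∀ t ∈ T, ∀ α γ : ℝ, ∃ w : NNReal,
      Measure.map (fun ω => α * f t ω + γ * f s ω) (ℙ : Measure Ω) =
        gaussianReal (α * μ t + γ * μ s) w ∧
      (w : ℝ) = α ^ 2 * σ t ^ 2 + 2 * (α * γ) * C t s + γ ^ 2 * σ s ^ 2 := by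
    intro s hs t ht α γ
    obtain ⟨m, w, h⟩ := hlaw s hs t ht α γ
    obtain ⟨h1, h2⟩ := gaussianReal_mean_variance_of_map_linear_combination (hLp t ht) (hLp s hs) h
    rw [← hμ t ht, ← hμ s hs] at h1
    rw [hcov t ht t ht, hcov t ht s hs, hcov s hs s hs, hσsq t ht, hσsq s hs] at h2
    exact ⟨w, h1 ▸ h, h2⟩
  have hnrm : ∀ s t : Fin d → ℝ, nrm (s - t) ^ β ≤ (d : ℝ) ^ β * dist s t ^ β := fun s t => by
    rw [← Real.mul_rpow hd'.le dist_nonneg]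
    exact Real.rpow_le_rpow (nrm_nonneg _) (nrm_sub_le_mul_dist s t) hβ.le
  have hnrmδ : ∀ s t : Fin d → ℝ, dist s t < δ / d → nrm (s - t) < δ := fun s t h => by
    rw [lt_div_iff₀ hd'] at h
    linarith [nrm_sub_le_mul_dist s t]
  have hδd : 0 < δ / d := by positivity
  have hσcont : ContinuousOn σ T := by
    refine continuousOn_of_abs_sub_le_rpow (K := κH * (d : ℝ) ^ β) hβ hδd fun s hs t ht hst => ?_
    have h1 := hA2 s hs t ht (hnrmδ s t hst)
    have h2 := mul_le_mul_of_nonneg_left (hnrm s t) hκH.le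
    linarith [abs_nonneg (μ t - μ s)]
  have hμcont : ContinuousOn μ T := by
    refine continuousOn_of_abs_sub_le_rpow (K := κH * (d : ℝ) ^ β) hβ hδd fun s hs t ht hst => ?_
    have h1 := hA2 s hs t ht (hnrmδ s t hst)
    have h2 := mul_le_mul_of_nonneg_left (hnrm s t) hκH.le
    linarith [abs_nonneg (σ t - σ s)]
  have hcorr : ∀ s ∈ T, ∀ t ∈ T, dist s t < δ / d →
      1 - C t s / (σ t * σ s) ≤ κH * (d : ℝ) ^ β * dist s t ^ β := by
    intro s hs t ht hst
    have h1 := hA3 s hs s hs t ht s hs (by rw [dist_comm] at hst; exact hnrmδ t s hst)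
      (by simpa [nrm] using hδ)
    have h0 : nrm (s - s) ^ β = 0 := by simp [nrm, Real.zero_rpow hβ.ne']
    have hs1 : C s s / (σ s * σ s) = 1 := by
      rw [hσsq s hs]
      have := (hσpos s hs).ne'
      field_simp
    rw [h0, add_zero, hs1] at h1
    have h2 := mul_le_mul_of_nonneg_left (hnrm t s) hκH.le
    rw [dist_comm t s] at h2
    linarith [neg_abs_le (C t s / (σ t * σ s) - 1)]
  obtain ⟨B, hB, hsup⟩ := exists_measure_exists_gt_le (ℙ : Measure Ω) hTcompact.isBounded
    (fun t ω => (f t ω - μ t) / σ t)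
    (by
      filter_upwards [hA1] with ω hω
      exact (hω.sub hμcont).div hσcont fun t ht => (hσpos t ht).ne')
    (K := κH * (d : ℝ) ^ β) (by positivity) hβ hδd (by
      intro s hs t ht hst l θ w hl hθ
      have hσt := hσpos t ht
      have hσs := hσpos s hs
      obtain ⟨x, hx1, hx2⟩ := hparam s hs t ht ((l + θ) / σ t) (-θ / σ s)
      have h := measure_ge_le_exp_of_map_eq_gaussianReal hx1
        (w + ((l + θ) / σ t * μ t + -θ / σ s * μ s))
      refine le_trans (measure_mono fun ω hω => ?_) (h.trans (ENNReal.ofReal_le_ofReal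
        (Real.exp_le_exp.2 ?_)))
      · simp only [Set.mem_ofPred_eq] at hω ⊢
        refine (add_le_add_left hω _).trans (le_of_eq ?_)
        field_simp
        ring
      · have h1 : (x : ℝ) / 2 = l ^ 2 / 2 + (l * θ + θ ^ 2) * (1 - C t s / (σ t * σ s)) := by
          rw [hx2]
          field_simp
          ring
        have h2 := mul_le_mul_of_nonneg_left (hcorr s hs t ht hst)
          (show 0 ≤ l * θ + θ ^ 2 by positivity)
        linarith)
  obtain ⟨c, hc, hmills⟩ := exists_le_gaussianReal_Ioi
  have htail : ∀ t ∈ T, ∀ b : ℝ, 1 ≤ (b - μ t) / σ t →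
      c * (((b - μ t) / σ t)⁻¹ * Real.exp (-((b - μ t) / σ t) ^ 2 / 2)) ≤
        (ℙ {ω | f t ω > b}).toReal := by
    intro t ht b hb
    have hσt := hσpos t ht
    obtain ⟨x, hx1, hx2⟩ := hparam t ht t ht (1 / σ t) 0
    have hx : x = 1 := by
      refine NNReal.coe_injective ?_
      rw [hx2, NNReal.coe_one]
      field_simp
      ring
    subst hx
    refine (hmills _ hb).trans (le_of_eq ?_)
    rw [← gaussianReal_real_Ioi_add (1 / σ t * μ t + 0 * μ t), ← hx1,
      map_measureReal_apply (by have := hfmeas t; fun_prop) measurableSet_Ioi]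
    refine congrArg (fun s => (ℙ s).toReal) ?_
    ext ω
    simp only [Set.mem_preimage, Set.mem_Ioi, zero_mul, add_zero, Set.mem_ofPred_eq, gt_iff_lt]
    rw [← mul_lt_mul_iff_right₀ hσt]
    field_simp
    simp
  have hle_sup : ∀ t ∈ T, ∀ b : ℝ, (ℙ {ω | f t ω > b}).toReal ≤
      sSup ((fun t => (ℙ {ω | f t ω > b}).toReal) '' T) := fun t ht b =>
    le_csSup ⟨1, by rintro _ ⟨s, _, rfl⟩; exact measureReal_le_one⟩ ⟨t, ht, rfl⟩
  obtain ⟨tσ, htσ, hσmax⟩ := hTcompact.exists_isMaxOn ⟨0, h0T⟩ hσcont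
  obtain ⟨tμ, htμ, hμmax⟩ := hTcompact.exists_isMaxOn ⟨0, h0T⟩ hμcont
  have hone : ∀ b, μ tμ + σ tσ ≤ b → ∀ t ∈ T, 1 ≤ (b - μ t) / σ t := fun b hb t ht => by
    rw [le_div_iff₀ (hσpos t ht)]
    have h1 : σ t ≤ σ tσ := hσmax ht
    have h2 : μ t ≤ μ tμ := hμmax ht
    linarith
  set e : ℝ := 2 * (d : ℝ) / β + 1 with he
  have he0 : 0 ≤ e := by positivity
  have hσ0 := hσpos 0 h0T
  set R : ℝ := (1 + |μ 0|) / σ 0 with hR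
  have hR0 : 0 < R := by positivity
  set p : ℝ := (ℙ {ω | f 0 ω > μ tμ + σ tσ}).toReal
  have hp0 : 0 < p := by
    have h1 := hone _ le_rfl 0 h0T
    refine lt_of_lt_of_le ?_ (htail 0 h0T _ h1)
    have : 0 < (μ tμ + σ tσ - μ 0) / σ 0 := by linarith
    positivity
  refine ⟨B * R ^ e / c + 1 / p, by positivity, fun b hb => ?_⟩
  have hb0 : 0 < b := by linarith
  set Q := sSup ((fun t => (ℙ {ω | f t ω > b}).toReal) '' T)
  have hQ0 : 0 ≤ Q := le_trans ENNReal.toReal_nonneg (hle_sup 0 h0T b)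
  have hbpow : b ^ e ≤ b ^ (2 * (d : ℝ) / β + (d : ℝ) * v + 1) := by
    refine Real.rpow_le_rpow_of_exponent_le hb ?_
    have : 0 < (d : ℝ) * v := by positivity
    linarith
  rcases lt_or_ge b (μ tμ + σ tσ) with hlt | hge
  · have hpQ : p ≤ Q := by
      refine le_trans ?_ (hle_sup 0 h0T b)
      exact measureReal_mono fun ω (hω : f 0 ω > μ tμ + σ tσ) => hlt.trans hω
    have h1 : 1 ≤ b ^ (2 * (d : ℝ) / β + (d : ℝ) * v + 1) :=
      (Real.one_le_rpow hb he0).trans hbpow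
    calc (ℙ {ω | ∃ t ∈ T, f t ω > b}).toReal ≤ 1 := measureReal_le_one
      _ = 1 / p * 1 * p := by field_simp
      _ ≤ _ := by
        gcongr
        have : 0 ≤ B * R ^ e / c := by positivity
        linarith
  · have hucont : ContinuousOn (fun t => (b - μ t) / σ t) T :=
      (continuousOn_const.sub hμcont).div hσcont fun t ht => (hσpos t ht).ne'
    obtain ⟨t₀, ht₀, hmin⟩ := hTcompact.exists_isMinOn ⟨0, h0T⟩ hucont
    have hu1 := hone b hge t₀ ht₀
    have htl := (htail t₀ ht₀ b hu1).trans (hle_sup t₀ ht₀ b)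
    have huR : (b - μ t₀) / σ t₀ ≤ R * b := by
      refine le_trans (hmin h0T) ?_
      have h1 := neg_abs_le (μ 0)
      have h2 : |μ 0| ≤ |μ 0| * b := le_mul_of_one_le_right (abs_nonneg _) hb
      rw [hR, div_mul_eq_mul_div]
      exact div_le_div_of_nonneg_right (by linarith) hσ0.le
    set u := (b - μ t₀) / σ t₀
    have hu0 : 0 < u := by linarith
    have hmain : (ℙ {ω | ∃ t ∈ T, f t ω > b}).toReal ≤
        B * (u ^ (2 * (d : ℝ) / β) * Real.exp (-u ^ 2 / 2)) := by
      refine ENNReal.toReal_le_of_le_ofReal (by positivity)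
        (le_trans (measure_mono fun ω hω => ?_) (hsup u hu1))
      obtain ⟨t, ht, hft⟩ := hω
      refine ⟨t, ht, lt_of_le_of_lt (hmin ht) ?_⟩
      exact div_lt_div_of_pos_right (sub_lt_sub_right hft _) (hσpos t ht)
    have hsplit : u ^ (2 * (d : ℝ) / β) = u ^ e * u⁻¹ := by
      rw [he, Real.rpow_add_one hu0.ne', mul_inv_cancel_right₀ hu0.ne']
    calc _ ≤ B * (u ^ (2 * (d : ℝ) / β) * Real.exp (-u ^ 2 / 2)) := hmain
      _ = B * u ^ e / c * (c * (u⁻¹ * Real.exp (-u ^ 2 / 2))) := by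
        rw [hsplit]
        field_simp
      _ ≤ B * (R * b) ^ e / c * Q := by gcongr
      _ = B * R ^ e / c * b ^ e * Q := by
        rw [Real.mul_rpow hR0.le hb0.le]
        ring
      _ ≤ _ := by
        gcongr
        have : 0 < 1 / p := by positivity
        linarith
end
end
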